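/- arXiv:2605.01550 — 5 statements merged into one kernel-verified Lean document; each statement's English description precedes it below -/
import Mathlib

section
/- Let α ∈ (0,1], let (X,d) be a compact metric space, and let F be a topological space whose elements are (identified with) Lipschitz self-maps of X. Suppose f ∈ F is F-stably hyperbolic and O is an f-periodic orbit. Then there exist a neighbourhood U of f in F and a constant C > 0 such that for every g ∈ U: (i) there exist maps h_g : Ω(f) → Ω(g) and i_g : Ω(g) → Ω(f) with h_g∘f = g∘h_g on Ω(f) and i_g∘g = f∘i_g on Ω(g); and (ii) setting O_g := h_g(O) and d_g := max{d∞(h_g,id), d∞(i_g,id)}, for every nonconstant φ ∈ C^α(X,ℝ) with M_max(f,φ) = {μ_O} and every ξ ∈ C^α(X,ℝ) with ⌈ξ⌉_α ≤ 5C·⌈φ⌉_α·d_g^{α/2} and sup|ξ| ≤ ⌈φ⌉_α·d_g^α, one has M_max(g, φ − 2C·⌈φ⌉_α·d_g^{α/2}·d(·,O_g)^α + ξ) = {μ_{O_g}}. -/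
open MeasureTheory Set Filter

section Defs

variable {X : Type*} [MetricSpace X]

/-- The nonwandering set of a self-map `f`. -/
def nonwanderingSet (f : X → X) : Set X :=
  {x | ∀ U ∈ nhds x, ∃ n : ℕ, 1 ≤ n ∧ ∃ y ∈ U, f^[n] y ∈ U}

/-- The (smallest) Lipschitz constant of `f`. -/
noncomputable def lipConst (f : X → X) : ℝ :=
  sInf {K : ℝ | 0 ≤ K ∧ ∀ x y, dist (f x) (f y) ≤ K * dist x y}

/-- `φ` is `α`-Hölder on `S`. -/
def IsHolderOn (α : ℝ) (S : Set X) (φ : X → ℝ) : Prop :=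
  ∃ C : ℝ, ∀ x ∈ S, ∀ y ∈ S, |φ x - φ y| ≤ C * dist x y ^ α

/-- Pointwise `α`-Hölder bound with constant `C` on `S`; equivalently,
the `α`-Hölder seminorm of `φ` on `S` is at most `C`. -/
def HolderBoundOn (C α : ℝ) (S : Set X) (φ : X → ℝ) : Prop :=
  ∀ x ∈ S, ∀ y ∈ S, |φ x - φ y| ≤ C * dist x y ^ α

/-- The `α`-Hölder seminorm of `φ` on `S`. -/
noncomputable def holderSemiOn (α : ℝ) (S : Set X) (φ : X → ℝ) : ℝ :=
  sInf {C : ℝ | 0 ≤ C ∧ ∀ x ∈ S, ∀ y ∈ S, |φ x - φ y| ≤ C * dist x y ^ α}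

/-- The uniform distance of `h` from the identity on `S`. -/
noncomputable def supDistOn (S : Set X) (h : X → X) : ℝ :=
  sSup ((fun x => dist (h x) x) '' S)

variable [MeasurableSpace X]

/-- `μ` is an `f`-invariant Borel probability measure. -/
def IsInvProb (f : X → X) (μ : Measure X) : Prop :=
  IsProbabilityMeasure μ ∧ μ.map f = μ

/-- The maximum ergodic average `Q(f, φ)`. -/
noncomputable def maxErgAvg (f : X → X) (φ : X → ℝ) : ℝ :=
  sSup {r : ℝ | ∃ μ : Measure X, IsInvProb f μ ∧ r = ∫ x, φ x ∂μ}

/-- The set of `(f, φ)`-maximizing measures. -/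
def maxMeasures (f : X → X) (φ : X → ℝ) : Set (Measure X) :=
  {μ : Measure X | IsInvProb f μ ∧ ∫ x, φ x ∂μ = maxErgAvg f φ}

/-- The uniform probability measure `μ_O` on a finite set `O`. -/
noncomputable def orbitMeasure (O : Finset X) : Measure X :=
  (O.card : ENNReal)⁻¹ • ∑ x ∈ O, Measure.dirac x

/-- `O` is an `f`-periodic orbit. -/
def IsPeriodicOrbit [DecidableEq X] (f : X → X) (O : Finset X) : Prop :=
  ∃ x p, 0 < p ∧ f^[p] x = x ∧ O = (Finset.range p).image fun i => f^[i] x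

/-- `f` is `𝓕`-stably hyperbolic: (IS) intertwining stability, (RHE) robust
hyperbolic estimates, and (ML) the Mañé lemma. -/
def StablyHyperbolic {F : Type*} [TopologicalSpace F] (ι : F → X → X) (f : F) : Prop :=
  -- (IS)
  (∀ ε > (0:ℝ), ∃ U ∈ nhds f, ∀ g ∈ U,
    lipConst (ι g) < 2 * lipConst (ι f) ∧
    ∃ h i : X → X,
      MapsTo h (nonwanderingSet (ι f)) (nonwanderingSet (ι g)) ∧
      MapsTo i (nonwanderingSet (ι g)) (nonwanderingSet (ι f)) ∧
      (∀ x ∈ nonwanderingSet (ι f), h (ι f x) = ι g (h x)) ∧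
      (∀ x ∈ nonwanderingSet (ι g), i (ι g x) = ι f (i x)) ∧
      (∀ x ∈ nonwanderingSet (ι f), dist (h x) x < ε) ∧
      (∀ x ∈ nonwanderingSet (ι g), dist (i x) x < ε)) ∧
  -- (RHE)
  (∃ U ∈ nhds f, ∃ K > (0:ℝ), ∃ δ > (0:ℝ), ∃ lam > (1:ℝ), ∀ g ∈ U,
    ∀ x ∈ nonwanderingSet (ι g), ∀ y ∈ nonwanderingSet (ι g), ∀ n : ℕ,
      (∀ m ≤ n, dist ((ι g)^[m] x) ((ι g)^[m] y) < δ) →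
      ∀ m ≤ n, dist ((ι g)^[m] x) ((ι g)^[m] y) ≤
        K * (lam ^ min m (n - m))⁻¹ *
          (dist x y + dist ((ι g)^[n] x) ((ι g)^[n] y))) ∧
  -- (ML)
  (∀ β : ℝ, 0 < β → β ≤ 1 → ∃ L > (0:ℝ), ∀ φ : X → ℝ, IsHolderOn β univ φ →
    ∃ u : X → ℝ,
      (∀ z ∈ nonwanderingSet (ι f), φ z + u z - u (ι f z) ≤ maxErgAvg (ι f) φ) ∧
      HolderBoundOn (L * holderSemiOn β univ φ) β (nonwanderingSet (ι f)) u)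

end Defs

theorem iterate_semiconjOn {X : Type*} {f g h : X → X} {S : Set X} (hf : MapsTo f S S)
    (hh : ∀ x ∈ S, h (f x) = g (h x)) {x : X} (hx : x ∈ S) (m : ℕ) :
    h (f^[m] x) = g^[m] (h x) := by
  induction m with
  | zero => rfl
  | succ m ih =>
    rw [Function.iterate_succ_apply', Function.iterate_succ_apply', hh _ (hf.iterate m hx), ih]

section PeriodicOrbit

variable {X : Type*} [DecidableEq X] {f : X → X} {O : Finset X}

theorem IsPeriodicOrbit.nonempty (hO : IsPeriodicOrbit f O) : O.Nonempty := by
  obtain ⟨x, p, hp, -, rfl⟩ := hO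
  exact ⟨_, Finset.mem_image_of_mem _ (Finset.mem_range.2 hp)⟩

theorem IsPeriodicOrbit.map_mem (hO : IsPeriodicOrbit f O) {y : X} (hy : y ∈ O) :
    f y ∈ O := by
  obtain ⟨x, p, hp, hx, rfl⟩ := hO
  obtain ⟨k, hk, rfl⟩ := Finset.mem_image.1 hy
  rw [← Function.iterate_succ_apply' f k x]
  rcases eq_or_ne (k + 1) p with h | h
  · exact Finset.mem_image.2 ⟨0, Finset.mem_range.2 hp, by rw [Nat.succ_eq_add_one, h, hx]; rfl⟩
  · exact Finset.mem_image.2 ⟨k + 1, by rw [Finset.mem_range] at hk ⊢; omega, rfl⟩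

theorem IsPeriodicOrbit.iterate_mem (hO : IsPeriodicOrbit f O) {y : X}
    (hy : y ∈ O) (m : ℕ) : f^[m] y ∈ O := by
  induction m with
  | zero => exact hy
  | succ m ih => rw [Function.iterate_succ_apply']; exact hO.map_mem ih

theorem IsPeriodicOrbit.card_eq_minimalPeriod_and_image
    (hO : IsPeriodicOrbit f O) {y : X} (hy : y ∈ O) :
    O.card = Function.minimalPeriod f y ∧
      O = (Finset.range (Function.minimalPeriod f y)).image fun i => f^[i] y := by
  have hO' := hO
  obtain ⟨x, p, hp, hx, hOx⟩ := hO
  have hper : x ∈ Function.periodicPts f := ⟨p, hp, hx⟩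
  obtain ⟨k, hk, rfl⟩ := Finset.mem_image.1 (hOx ▸ hy)
  have hmin := Function.minimalPeriod_apply_iterate hper k
  have hpos := Function.minimalPeriod_pos_of_mem_periodicPts hper
  have hinj : ∀ z : X, Set.InjOn (fun i => f^[i] z)
      (Finset.range (Function.minimalPeriod f z) : Set ℕ) := by
    intro z
    simpa [Finset.coe_range] using! Function.iterate_injOn_Iio_minimalPeriod (f := f) (x := z)
  have hcx : O.card = Function.minimalPeriod f x := by
    have : O = (Finset.range (Function.minimalPeriod f x)).image fun i => f^[i] x := by
      rw [hOx]
      ext z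
      simp only [Finset.mem_image, Finset.mem_range]
      constructor
      · rintro ⟨a, -, rfl⟩
        exact ⟨a % Function.minimalPeriod f x, Nat.mod_lt _ hpos,
          Function.iterate_mod_minimalPeriod_eq⟩
      · rintro ⟨a, ha, rfl⟩
        exact ⟨a, ha.trans_le (Function.IsPeriodicPt.minimalPeriod_le hp hx), rfl⟩
    rw [this, Finset.card_image_of_injOn (hinj x), Finset.card_range]
  refine ⟨hcx.trans hmin.symm, ?_⟩
  symm
  apply Finset.eq_of_subset_of_card_le
  · intro z hz
    obtain ⟨a, -, rfl⟩ := Finset.mem_image.1 hz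
    exact hO'.iterate_mem hy a
  · rw [Finset.card_image_of_injOn (hinj _), Finset.card_range, hcx, hmin]

theorem IsPeriodicOrbit.sum_iterate {M : Type*} [AddCommMonoid M]
    (hO : IsPeriodicOrbit f O) {y : X} (hy : y ∈ O) (T : X → M) :
    ∑ m ∈ Finset.range O.card, T (f^[m] y) = ∑ z ∈ O, T z := by
  obtain ⟨h1, h2⟩ := hO.card_eq_minimalPeriod_and_image hy
  conv_rhs => rw [h2]
  rw [Finset.sum_image, h1]
  simpa [Finset.coe_range] using! Function.iterate_injOn_Iio_minimalPeriod (f := f) (x := y)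

theorem IsPeriodicOrbit.iterate_card (hO : IsPeriodicOrbit f O) {y : X}
    (hy : y ∈ O) : f^[O.card] y = y := by
  rw [(hO.card_eq_minimalPeriod_and_image hy).1]
  exact Function.isPeriodicPt_minimalPeriod f y

theorem IsPeriodicOrbit.sum_comp {M : Type*} [AddCommMonoid M]
    (hO : IsPeriodicOrbit f O) (T : X → M) : ∑ z ∈ O, T (f z) = ∑ z ∈ O, T z := by
  obtain ⟨y, hy⟩ := hO.nonempty
  rw [← hO.sum_iterate hy, ← hO.sum_iterate (hO.map_mem hy)]
  simp only [← Function.iterate_succ_apply, ← Function.iterate_succ_apply']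

theorem IsPeriodicOrbit.subset_nonwanderingSet [MetricSpace X] (hO : IsPeriodicOrbit f O)
    {y : X} (hy : y ∈ O) : y ∈ nonwanderingSet f := fun U hU =>
  ⟨O.card, hO.nonempty.card_pos, y, mem_of_mem_nhds hU,
    by rw [hO.iterate_card hy]; exact mem_of_mem_nhds hU⟩

theorem IsPeriodicOrbit.image_of_semiconj {g h : X → X} (hO : IsPeriodicOrbit f O)
    (hh : ∀ x ∈ O, h (f x) = g (h x)) : IsPeriodicOrbit g (O.image h) := by
  have hO' := hO
  obtain ⟨x, p, hp, hx, hOx⟩ := hO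
  have hxO : x ∈ O := hOx ▸ Finset.mem_image.2 ⟨0, Finset.mem_range.2 hp, rfl⟩
  have key := iterate_semiconjOn (S := (O : Set X)) (fun _ hy => hO'.map_mem hy) hh hxO
  refine ⟨h x, p, hp, by rw [← key, hx], ?_⟩
  rw [hOx, Finset.image_image]
  exact Finset.image_congr fun m _ => key m

end PeriodicOrbit

section InvariantMeasure

variable {X : Type*} [MeasurableSpace X] {f : X → X}

theorem IsInvProb.measurePreserving {μ : Measure X} (hμ : IsInvProb f μ) (hf : Measurable f) :
    MeasurePreserving f μ μ := ⟨hf, hμ.2⟩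

theorem IsInvProb.ae_mem_nonwanderingSet [MetricSpace X] [SecondCountableTopology X] [OpensMeasurableSpace X]
    {μ : Measure X} (hμ : IsInvProb f μ) (hf : Measurable f) :
    ∀ᵐ x ∂μ, x ∈ nonwanderingSet f := by
  have := hμ.1
  filter_upwards [(hμ.measurePreserving hf).conservative.ae_frequently_mem_of_mem_nhds]
    with x hx U hU
  obtain ⟨n, hn, hnU⟩ := Filter.frequently_atTop.1 (hx U hU) 1
  exact ⟨n, hn, x, mem_of_mem_nhds hU, hnU⟩

theorem IsInvProb.integral_nonpos_of_birkhoffSum_le {μ : Measure X} (hμ : IsInvProb f μ)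
    (hf : Measurable f) {θ : X → ℝ} (hθ : Integrable θ μ) {D : ℝ}
    (hD : ∀ᵐ x ∂μ, ∀ n : ℕ, ∑ m ∈ Finset.range n, θ (f^[m] x) ≤ D) : ∫ x, θ x ∂μ ≤ 0 := by
  have := hμ.1
  have hmp := hμ.measurePreserving hf
  have hinteg : ∀ m : ℕ, Integrable (fun x => θ (f^[m] x)) μ := fun m =>
    (hmp.iterate m).integrable_comp_of_integrable hθ
  have heq : ∀ m : ℕ, ∫ x, θ (f^[m] x) ∂μ = ∫ x, θ x ∂μ := by
    intro m
    have hm := hmp.iterate m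
    conv_rhs => rw [← hm.map_eq]
    rw [integral_map hm.measurable.aemeasurable]
    rw [hm.map_eq]
    exact hθ.aestronglyMeasurable
  have hbd : ∀ n : ℕ, n * ∫ x, θ x ∂μ ≤ D := by
    intro n
    calc n * ∫ x, θ x ∂μ = ∫ x, ∑ m ∈ Finset.range n, θ (f^[m] x) ∂μ := by
          rw [integral_finsetSum _ fun m _ => hinteg m]
          simp [heq]
      _ ≤ ∫ _, D ∂μ :=
          integral_mono_ae (integrable_finsetSum _ fun m _ => hinteg m) (integrable_const D)
            (hD.mono fun x hx => hx n)
      _ = D := by simp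
  by_contra! hpos
  obtain ⟨n, hn⟩ := exists_nat_gt (D / ∫ x, θ x ∂μ)
  rw [div_lt_iff₀ hpos] at hn
  exact absurd (hbd n) (not_le.2 hn)

theorem maxMeasures_congr [MetricSpace X] [SecondCountableTopology X] [OpensMeasurableSpace X] {g : X → X}
    (hf : Measurable f) (hg : Measurable g) (hΩ : nonwanderingSet f = nonwanderingSet g)
    (hfg : ∀ x ∈ nonwanderingSet f, f x = g x) (ψ : X → ℝ) :
    maxMeasures g ψ = maxMeasures f ψ := by
  have hiff : ∀ μ, IsInvProb g μ ↔ IsInvProb f μ := by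
    intro μ
    constructor
    · intro h
      refine ⟨h.1, ?_⟩
      rw [Measure.map_congr (g := g), h.2]
      filter_upwards [h.ae_mem_nonwanderingSet hg] with x hx
      exact hfg x (hΩ ▸ hx)
    · intro h
      refine ⟨h.1, ?_⟩
      rw [Measure.map_congr (g := f), h.2]
      filter_upwards [h.ae_mem_nonwanderingSet hf] with x hx
      exact (hfg x hx).symm
  simp only [maxMeasures, maxErgAvg, hiff]

theorem orbitMeasure_apply (O : Finset X) {s : Set X} (hs : MeasurableSet s) :
    orbitMeasure O s = (O.card : ENNReal)⁻¹ * ∑ z ∈ O, s.indicator 1 z := by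
  simp [orbitMeasure, hs]

theorem integral_orbitMeasure [MeasurableSingletonClass X] (O : Finset X)
    (θ : X → ℝ) :
    ∫ x, θ x ∂(orbitMeasure O) = (O.card : ℝ)⁻¹ * ∑ z ∈ O, θ z := by
  have hinteg : ∀ z ∈ O, Integrable θ (Measure.dirac z) := fun z _ =>
    integrable_dirac (by simp)
  rw [orbitMeasure, integral_smul_measure, integral_finsetSum_measure hinteg]
  simp [integral_dirac]

variable [DecidableEq X] {O : Finset X}

theorem IsPeriodicOrbit.isInvProb_orbitMeasure (hO : IsPeriodicOrbit f O) (hf : Measurable f) :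
    IsInvProb f (orbitMeasure O) := by
  have hc : (O.card : ENNReal) ≠ 0 := by simpa using hO.nonempty.ne_empty
  refine ⟨⟨?_⟩, ?_⟩
  · rw [orbitMeasure_apply O MeasurableSet.univ]
    simp [ENNReal.inv_mul_cancel hc]
  · ext s hs
    rw [Measure.map_apply hf hs, orbitMeasure_apply O (hf hs), orbitMeasure_apply O hs,
      ← hO.sum_comp (s.indicator 1)]
    rfl

theorem IsPeriodicOrbit.eq_orbitMeasure (hO : IsPeriodicOrbit f O) (hf : Measurable f)
    {μ : Measure X} (hμ : IsInvProb f μ) (h : ∀ᵐ x ∂μ, x ∈ O) : μ = orbitMeasure O := by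
  have := hμ.1
  have hmp := hμ.measurePreserving hf
  have hc : (O.card : ENNReal) ≠ 0 := by simpa using hO.nonempty.ne_empty
  ext s hs
  have hind : Measurable (s.indicator (1 : X → ENNReal)) := measurable_one.indicator hs
  have key : O.card * μ s = ∑ z ∈ O, s.indicator 1 z := by
    calc O.card * μ s = ∑ m ∈ Finset.range O.card, ∫⁻ x, s.indicator 1 (f^[m] x) ∂μ := by
          have : ∀ m : ℕ, ∫⁻ x, s.indicator 1 (f^[m] x) ∂μ = μ s := fun m => by
            rw [(hmp.iterate m).lintegral_comp hind, lintegral_indicator_one hs]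
          simp [this]
      _ = ∫⁻ x, ∑ m ∈ Finset.range O.card, s.indicator 1 (f^[m] x) ∂μ :=
          (lintegral_finsetSum _ fun m _ => hind.comp (hmp.iterate m).measurable).symm
      _ = ∫⁻ _, ∑ z ∈ O, s.indicator 1 z ∂μ :=
          lintegral_congr_ae (h.mono fun x hx => hO.sum_iterate hx _)
      _ = _ := by simp
  rw [orbitMeasure_apply O hs, ← key, ← mul_assoc, ENNReal.inv_mul_cancel hc (by simp), one_mul]

theorem maxMeasures_eq_of_integral_le (hO : IsPeriodicOrbit f O) (hf : Measurable f) {ψ : X → ℝ}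
    (hψ : ∀ μ, IsInvProb f μ → ∫ x, ψ x ∂μ ≤ ∫ x, ψ x ∂(orbitMeasure O))
    (huniq : ∀ μ, IsInvProb f μ → ∫ x, ψ x ∂(orbitMeasure O) ≤ ∫ x, ψ x ∂μ →
      ∀ᵐ x ∂μ, x ∈ O) :
    maxMeasures f ψ = {orbitMeasure O} := by
  have hinv := hO.isInvProb_orbitMeasure hf
  have hQ : maxErgAvg f ψ = ∫ x, ψ x ∂(orbitMeasure O) := by
    apply IsGreatest.csSup_eq
    refine ⟨⟨_, hinv, rfl⟩, ?_⟩
    rintro r ⟨μ, hμ, rfl⟩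
    exact hψ μ hμ
  ext μ
  simp only [maxMeasures, Set.mem_ofPred_eq, Set.mem_singleton_iff, hQ]
  constructor
  · rintro ⟨hμ, h⟩
    exact hO.eq_orbitMeasure hf hμ (huniq μ hμ h.ge)
  · rintro rfl
    exact ⟨hinv, rfl⟩

end InvariantMeasure

section Hoelder

variable {X : Type*} [MetricSpace X] {α : ℝ}

theorem le_sInf_mul_of_forall_le {ι' : Sort*} {a b : ι' → ℝ} (hb : ∀ j, 0 ≤ b j)
    (hne : ∃ C : ℝ, 0 ≤ C ∧ ∀ j, a j ≤ C * b j) (j : ι') :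
    a j ≤ sInf {C : ℝ | 0 ≤ C ∧ ∀ j, a j ≤ C * b j} * b j := by
  rcases (hb j).eq_or_lt with h | h
  · obtain ⟨C, -, hC⟩ := hne
    simpa [← h] using hC j
  · rw [← div_le_iff₀ h]
    refine le_csInf hne ?_
    rintro C ⟨-, hC⟩
    rw [div_le_iff₀ h]
    exact hC j

theorem dist_le_lipConst_mul {g : X → X} {K : NNReal} (hg : LipschitzWith K g) (x y : X) :
    dist (g x) (g y) ≤ lipConst g * dist x y := by
  have := le_sInf_mul_of_forall_le (a := fun p : X × X => dist (g p.1) (g p.2))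
    (b := fun p => dist p.1 p.2) (fun _ => dist_nonneg)
    ⟨K, K.2, fun p => hg.dist_le_mul p.1 p.2⟩ (x, y)
  simpa [Prod.forall, lipConst] using this

theorem holderSemiOn_nonneg {S : Set X} {φ : X → ℝ} : 0 ≤ holderSemiOn α S φ :=
  Real.sInf_nonneg fun _ hC => hC.1

theorem IsHolderOn.holderBoundOn_univ {φ : X → ℝ} (hφ : IsHolderOn α Set.univ φ) :
    HolderBoundOn (holderSemiOn α Set.univ φ) α Set.univ φ := by
  intro x _ y _
  obtain ⟨C, hC⟩ := hφ
  have := le_sInf_mul_of_forall_le (a := fun p : X × X => |φ p.1 - φ p.2|)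
    (b := fun p => dist p.1 p.2 ^ α) (fun _ => Real.rpow_nonneg dist_nonneg _)
    ⟨|C|, abs_nonneg C, fun p => (hC p.1 trivial p.2 trivial).trans
      (mul_le_mul_of_nonneg_right (le_abs_self C) (Real.rpow_nonneg dist_nonneg _))⟩ (x, y)
  simpa [Prod.forall, holderSemiOn] using this

theorem IsHolderOn.holderSemiOn_pos {φ : X → ℝ} (hφ : IsHolderOn α Set.univ φ)
    (hne : ∃ x y, φ x ≠ φ y) : 0 < holderSemiOn α Set.univ φ := by
  obtain ⟨x, y, hxy⟩ := hne
  refine holderSemiOn_nonneg.lt_of_ne fun h => ?_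
  have := hφ.holderBoundOn_univ x trivial y trivial
  rw [← h, zero_mul] at this
  exact hxy (sub_eq_zero.1 (abs_nonpos_iff.1 this))

theorem HolderBoundOn.continuous {φ : X → ℝ} {C : ℝ} (hα : 0 < α)
    (hφ : HolderBoundOn C α Set.univ φ) : Continuous φ := by
  rw [continuous_iff_continuousAt]
  intro x
  rw [ContinuousAt, tendsto_iff_dist_tendsto_zero]
  have hlim : Tendsto (fun y => C * dist y x ^ α) (nhds x) (nhds 0) := by
    have : Continuous fun y => C * dist y x ^ α :=
      continuous_const.mul ((continuous_id.dist continuous_const).rpow_const fun _ => Or.inr hα.le)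
    simpa [Real.zero_rpow hα.ne'] using this.tendsto x
  refine squeeze_zero (fun _ => dist_nonneg) (fun y => ?_) hlim
  rw [Real.dist_eq]
  exact hφ y trivial x trivial

theorem supDistOn_nonneg (S : Set X) (h : X → X) : 0 ≤ supDistOn S h :=
  Real.sSup_nonneg (by rintro _ ⟨x, -, rfl⟩; exact dist_nonneg)

theorem supDistOn_le {S : Set X} {h : X → X} {ε : ℝ} (hε : 0 ≤ ε)
    (hh : ∀ x ∈ S, dist (h x) x < ε) : supDistOn S h ≤ ε :=
  Real.sSup_le (by rintro _ ⟨x, hx, rfl⟩; exact (hh x hx).le) hε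

theorem dist_le_supDistOn {S : Set X} {h : X → X} {ε : ℝ} (hh : ∀ x ∈ S, dist (h x) x < ε)
    {x : X} (hx : x ∈ S) : dist (h x) x ≤ supDistOn S h :=
  le_csSup ⟨ε, by rintro _ ⟨y, hy, rfl⟩; exact (hh y hy).le⟩ ⟨x, hx, rfl⟩

theorem mapsTo_nonwanderingSet {g : X → X} (hg : Continuous g) :
    MapsTo g (nonwanderingSet g) (nonwanderingSet g) := by
  intro x hx U hU
  obtain ⟨n, hn, y, hy, hyn⟩ := hx _ (hg.continuousAt.preimage_mem_nhds hU)
  refine ⟨n, hn, g y, hy, ?_⟩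
  rw [← Function.iterate_succ_apply, Function.iterate_succ_apply']
  exact hyn

end Hoelder

section Sums

theorem sum_range_le_of_excursions {r a : ℕ → ℝ} {ρ δ e E G : ℝ} (he : 0 ≤ e) (hE : 0 ≤ E)
    (hρδ : ρ ≤ δ) (hG : E + e ≤ G) (hr : ∀ m, r m ≤ e) (hr0 : ∀ m, ρ ≤ a m → r m ≤ 0)
    (hrG : ∀ m, δ ≤ a m → r m ≤ -G)
    (hchain : ∀ s n, (∀ m ≤ n, a (s + m) < δ) → a s < ρ → a (s + n) < ρ →
      ∑ m ∈ Finset.range n, r (s + m) ≤ E) (N : ℕ) :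
    ∑ m ∈ Finset.range N, r m ≤ E + e := by
  have key : (∑ m ∈ Finset.range N, r m ≤ 0) ∨ ∃ s n, s + n < N ∧
      ∑ m ∈ Finset.range s, r m ≤ 0 ∧ a s < ρ ∧ a (s + n) < ρ ∧
      (∀ m, s ≤ m → m < N → a m < δ) ∧
      ∑ m ∈ Finset.range N, r m ≤ ∑ m ∈ Finset.range (s + n), r m + e := by
    have hbd : ∀ N s n, s + n < N → ∑ m ∈ Finset.range s, r m ≤ 0 → a s < ρ → a (s + n) < ρ →
        (∀ m, s ≤ m → m < N → a m < δ) → ∑ m ∈ Finset.range (s + n), r m ≤ E := by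
      intro N s n hsn hs has hasn hδ
      rw [Finset.sum_range_add]
      have := hchain s n (fun m hm => hδ _ (by omega) (by omega)) has hasn
      linarith
    induction N with
    | zero => left; simp
    | succ N ih =>
      rcases ih with h | ⟨s, n, hsn, hs, has, hasn, hδ, hle⟩
      · rcases lt_or_ge (a N) ρ with ha | ha
        · right
          refine ⟨N, 0, by omega, h, ha, ha, fun m h1 h2 => ?_, ?_⟩
          · obtain rfl : m = N := by omega
            exact ha.trans_le hρδ
          · rw [Finset.sum_range_succ, add_zero]
            linarith [hr N]
        · left
          rw [Finset.sum_range_succ]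
          linarith [hr0 N ha]
      · have hE' := hbd N s n hsn hs has hasn hδ
        rcases lt_or_ge (a N) δ with ha | ha
        · right
          have hδ' : ∀ m, s ≤ m → m < N + 1 → a m < δ := fun m h1 h2 => by
            rcases eq_or_ne m N with rfl | h
            · exact ha
            · exact hδ m h1 (by omega)
          rcases lt_or_ge (a N) ρ with ha' | ha'
          · refine ⟨s, N - s, by omega, hs, has, ?_, hδ', ?_⟩
            · rwa [Nat.add_sub_cancel' (by omega)]
            · rw [Nat.add_sub_cancel' (by omega), Finset.sum_range_succ]
              linarith [hr N]
          · refine ⟨s, n, by omega, hs, has, hasn, hδ', ?_⟩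
            rw [Finset.sum_range_succ]
            linarith [hr0 N ha']
        · left
          rw [Finset.sum_range_succ]
          linarith [hrG N ha]
  rcases key with h | ⟨s, n, hsn, hs, has, hasn, hδ, hle⟩
  · linarith
  · rw [Finset.sum_range_add] at hle
    have := hchain s n (fun m hm => hδ _ (by omega) (by omega)) has hasn
    linarith

theorem sum_range_periodic_le {b : ℕ → ℝ} {q : ℕ} {B : ℝ} (hq : 0 < q) (hB : 0 ≤ B)
    (hper : ∀ m, b (q + m) = b m) (h0 : ∑ m ∈ Finset.range q, b m = 0) (hb : ∀ m, b m ≤ B)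
    (n : ℕ) : ∑ m ∈ Finset.range n, b m ≤ q * B := by
  induction n using Nat.strong_induction_on with
  | _ n ih =>
    rcases le_or_gt q n with h | h
    · obtain ⟨k, rfl⟩ := Nat.exists_eq_add_of_le h
      rw [Finset.sum_range_add, h0, zero_add]
      simp only [hper]
      exact ih k (by omega)
    · calc ∑ m ∈ Finset.range n, b m ≤ ∑ _m ∈ Finset.range n, B :=
            Finset.sum_le_sum fun m _ => hb m
        _ = n * B := by simp
        _ ≤ q * B := by gcongr

theorem sum_range_pow_min_le {q : ℝ} (hq0 : 0 ≤ q) (hq1 : q < 1) (n : ℕ) :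
    ∑ m ∈ Finset.range n, q ^ min m (n - m) ≤ 2 / (1 - q) := by
  have hgeom : ∑ m ∈ Finset.range n, q ^ m ≤ 1 / (1 - q) := by
    rw [one_div, ← tsum_geometric_of_lt_one hq0 hq1]
    exact (summable_geometric_of_lt_one hq0 hq1).sum_le_tsum _ fun m _ => pow_nonneg hq0 m
  have hrefl : ∑ m ∈ Finset.range n, q ^ (n - 1 - m) ≤ 1 / (1 - q) := by
    rw [Finset.sum_range_reflect (fun m => q ^ m) n]
    exact hgeom
  calc ∑ m ∈ Finset.range n, q ^ min m (n - m)
      ≤ ∑ m ∈ Finset.range n, (q ^ m + q ^ (n - 1 - m)) := by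
        refine Finset.sum_le_sum fun m _ => ?_
        rcases min_choice m (n - m) with h | h
        · rw [h]; exact le_add_of_nonneg_right (pow_nonneg hq0 _)
        · rw [h]
          exact (pow_le_pow_of_le_one hq0 hq1.le (by omega)).trans
            (le_add_of_nonneg_left (pow_nonneg hq0 _))
    _ ≤ 1 / (1 - q) + 1 / (1 - q) := by rw [Finset.sum_add_distrib]; exact add_le_add hgeom hrefl
    _ = 2 / (1 - q) := by ring

theorem sum_rpow_le_of_hyperbolic {α K lam ρ : ℝ} (hα : 0 < α) (hK : 0 < K) (hlam : 1 < lam)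
    (hρ : 0 ≤ ρ) {n : ℕ} {a : ℕ → ℝ} (ha0 : ∀ m, 0 ≤ a m)
    (ha : ∀ m ≤ n, a m ≤ K * (lam ^ min m (n - m))⁻¹ * ρ) :
    ∑ m ∈ Finset.range n, a m ^ α ≤ K ^ α * (2 / (1 - (lam⁻¹) ^ α)) * ρ ^ α := by
  have hlam0 : 0 < lam := one_pos.trans hlam
  have hq0 : 0 ≤ (lam⁻¹) ^ α := Real.rpow_nonneg (inv_nonneg.2 hlam0.le) _
  have hq1 : (lam⁻¹) ^ α < 1 := 
    Real.rpow_lt_one (inv_nonneg.2 hlam0.le) (inv_lt_one_of_one_lt₀ hlam) hα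
  calc ∑ m ∈ Finset.range n, a m ^ α
      ≤ ∑ m ∈ Finset.range n, K ^ α * ρ ^ α * ((lam⁻¹) ^ α) ^ min m (n - m) := by
        refine Finset.sum_le_sum fun m hm => ?_
        have hpow : ((lam⁻¹) ^ α) ^ min m (n - m) = ((lam ^ min m (n - m))⁻¹) ^ α := by
          rw [← inv_pow, Real.rpow_pow_comm (inv_nonneg.2 hlam0.le)]
        calc a m ^ α ≤ (K * (lam ^ min m (n - m))⁻¹ * ρ) ^ α :=
              Real.rpow_le_rpow (ha0 m) (ha m (Finset.mem_range.1 hm).le) hα.le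
          _ = _ := by
              rw [hpow, Real.mul_rpow (by positivity) hρ, Real.mul_rpow hK.le (by positivity)]
              ring
    _ = K ^ α * ρ ^ α * ∑ m ∈ Finset.range n, ((lam⁻¹) ^ α) ^ min m (n - m) := by
        rw [Finset.mul_sum]
    _ ≤ K ^ α * ρ ^ α * (2 / (1 - (lam⁻¹) ^ α)) := by
        gcongr
        exact sum_range_pow_min_le hq0 hq1 n
    _ = _ := by ring

end Sums

section Perturbation

theorem sum_range_coboundary {X : Type*} {g : X → X} (v : X → ℝ) (x : X) (n : ℕ) :
    ∑ m ∈ Finset.range n, (v (g^[m] x) - v (g^[m + 1] x)) = v x - v (g^[n] x) :=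
  Finset.sum_range_sub' (fun m => v (g^[m] x)) n

theorem IsPeriodicOrbit.sum_range_sub_average_le {X : Type*} [DecidableEq X] {g : X → X} {P : Finset X}
    (hP : IsPeriodicOrbit g P) {Φ v : X → ℝ} {Q κ β : ℝ} (hκ : 0 ≤ κ)
    (hβ : β = (P.card : ℝ)⁻¹ * ∑ y ∈ P, Φ y)
    (hcob : ∀ y ∈ P, |Φ y + v y - v (g y) - Q| ≤ κ) :
    |β - Q| ≤ κ ∧ ∀ y ∈ P, ∀ n,
      ∑ m ∈ Finset.range n, (Φ (g^[m] y) + v (g^[m] y) - v (g^[m + 1] y) - β) ≤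
        P.card * (2 * κ) := by
  have hc : (0 : ℝ) < P.card := by exact_mod_cast hP.nonempty.card_pos
  have hsum : ∑ y ∈ P, (Φ y + v y - v (g y)) = P.card * β := by
    rw [Finset.sum_sub_distrib, Finset.sum_add_distrib, hP.sum_comp v, hβ]
    field_simp
    ring
  have hβQ : |β - Q| ≤ κ := by
    have : P.card * (β - Q) = ∑ y ∈ P, (Φ y + v y - v (g y) - Q) := by
      rw [Finset.sum_sub_distrib, hsum]
      simp
      ring
    have h2 : P.card * |β - Q| ≤ P.card * κ := by
      rw [← abs_of_pos hc, ← abs_mul, this, abs_of_pos hc]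
      calc _ ≤ ∑ y ∈ P, |Φ y + v y - v (g y) - Q| := Finset.abs_sum_le_sum_abs _ _
        _ ≤ ∑ _y ∈ P, κ := Finset.sum_le_sum hcob
        _ = _ := by simp
    exact le_of_mul_le_mul_left h2 hc
  refine ⟨hβQ, fun y hy n => ?_⟩
  have hcard := hP.iterate_card hy
  refine sum_range_periodic_le hP.nonempty.card_pos (by linarith) (fun m => ?_) ?_ (fun m => ?_) n
  · rw [show P.card + m + 1 = (m + 1) + P.card by ring, add_comm P.card m,
      Function.iterate_add_apply, Function.iterate_add_apply, hcard]
  · have := hP.sum_iterate hy fun z => Φ z + v z - v (g z) - β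
    simp only [← Function.iterate_succ_apply'] at this
    rw [this, Finset.sum_sub_distrib, hsum]
    simp
  · have h1 := hcob _ (hP.iterate_mem hy m)
    rw [← Function.iterate_succ_apply' g m y] at h1
    rw [abs_le] at h1 hβQ
    linarith [h1.2, hβQ.1]

variable {X : Type*} [MetricSpace X]

/-- An orbit segment staying close to a separated forward invariant finite set follows a single
orbit of that set. -/
theorem exists_shadowed_orbit {g : X → X} {P : Finset X} {Λ δ ρ : ℝ} (hPne : P.Nonempty)
    (hPg : ∀ y ∈ P, g y ∈ P) (hρδ : ρ ≤ δ) (hΛ0 : 0 ≤ Λ)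
    (hΛ : ∀ x y, dist (g x) (g y) ≤ Λ * dist x y)
    (hsep : ∀ y ∈ P, ∀ y' ∈ P, y ≠ y' → Λ * δ + δ ≤ dist y y' ∧ 2 * δ ≤ dist y y') {x : X} {n : ℕ}
    (hx : ∀ m ≤ n, Metric.infDist (g^[m] x) (P : Set X) < δ)
    (hx0 : Metric.infDist x (P : Set X) < ρ) (hxn : Metric.infDist (g^[n] x) (P : Set X) < ρ) :
    ∃ y ∈ P, (∀ m ≤ n, dist (g^[m] x) (g^[m] y) < δ) ∧ dist x y < ρ ∧
      dist (g^[n] x) (g^[n] y) < ρ := by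
  have hne : (P : Set X).Nonempty := hPne
  obtain ⟨y, hy, hxy⟩ := (Metric.infDist_lt_iff hne).1 hx0
  have hyP : ∀ m, g^[m] y ∈ P := by
    intro m
    induction m with
    | zero => exact hy
    | succ m ih => rw [Function.iterate_succ_apply']; exact hPg _ ih
  have hδ : ∀ m ≤ n, dist (g^[m] x) (g^[m] y) < δ := by
    intro m
    induction m with
    | zero => intro _; exact hxy.trans_le hρδ
    | succ m ih =>
      intro hm
      obtain ⟨z, hz, hxz⟩ := (Metric.infDist_lt_iff hne).1 (hx (m + 1) hm)
      have h1 : dist (g^[m + 1] x) (g^[m + 1] y) ≤ Λ * δ := by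
        rw [Function.iterate_succ_apply', Function.iterate_succ_apply']
        exact (hΛ _ _).trans (mul_le_mul_of_nonneg_left (ih (by omega)).le hΛ0)
      have : g^[m + 1] y = z := by
        by_contra hne'
        have h2 := (hsep _ (hyP (m + 1)) z hz hne').1
        have h3 := dist_triangle_left (g^[m + 1] y) z (g^[m + 1] x)
        linarith
      rw [this]
      exact hxz
  refine ⟨y, hy, hδ, hxy, ?_⟩
  obtain ⟨z, hz, hxz⟩ := (Metric.infDist_lt_iff hne).1 hxn
  have : g^[n] y = z := by
    by_contra hne'
    have h2 := (hsep _ (hyP n) z hz hne').2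
    have h3 := dist_triangle_left (g^[n] y) z (g^[n] x)
    have h4 := hδ n le_rfl
    linarith
  rw [this]
  exact hxz

variable [DecidableEq X]

/-- If `Φ` is, up to a coboundary and a small error `κ`, at most its average on the periodic
orbit `P`, then the penalised potential `Φ - c * d(·, P) ^ α` has Birkhoff sums bounded above by
those of its average on `P`. -/
theorem IsPeriodicOrbit.sum_range_penalised_le {g : X → X} {P : Finset X} {S : Set X}
    (hP : IsPeriodicOrbit g P) (hPS : ∀ y ∈ P, y ∈ S) (hS : MapsTo g S S)
    {α Λ δ ρ K lam : ℝ} (hα : 0 < α) (hρ : 0 ≤ ρ) (hρδ : ρ ≤ δ) (hΛ0 : 0 ≤ Λ)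
    (hΛ : ∀ x y, dist (g x) (g y) ≤ Λ * dist x y)
    (hsep : ∀ y ∈ P, ∀ y' ∈ P, y ≠ y' → Λ * δ + δ ≤ dist y y' ∧ 2 * δ ≤ dist y y')
    (hK : 0 < K) (hlam : 1 < lam)
    (hhyp : ∀ x ∈ S, ∀ y ∈ S, ∀ n : ℕ, (∀ m ≤ n, dist (g^[m] x) (g^[m] y) < δ) →
      ∀ m ≤ n, dist (g^[m] x) (g^[m] y) ≤
        K * (lam ^ min m (n - m))⁻¹ * (dist x y + dist (g^[n] x) (g^[n] y)))
    {Φ v : X → ℝ} {H V w Q κ β c : ℝ} (hκ : 0 ≤ κ) (hc : 0 ≤ c) (hH : 0 ≤ H) (hV : 0 ≤ V)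
    (hw : 0 ≤ w)
    (hΦ : HolderBoundOn H α Set.univ Φ)
    (hv : ∀ x ∈ S, ∀ y ∈ S, |v x - v y| ≤ V * dist x y ^ α + w)
    (hsub : ∀ x ∈ S, Φ x + v x - v (g x) ≤ Q + κ)
    (hcob : ∀ y ∈ P, |Φ y + v y - v (g y) - Q| ≤ κ)
    (hβ : β = (P.card : ℝ)⁻¹ * ∑ y ∈ P, Φ y)
    (hρc : 2 * κ ≤ c * ρ ^ α)
    (hδc : H * ((2 * K) ^ α * (2 / (1 - (lam⁻¹) ^ α)) * ρ ^ α) + P.card * (2 * κ) +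
      2 * (V * ρ ^ α + w) + 2 * κ ≤ c * δ ^ α - 2 * κ)
    {x : X} (hx : x ∈ S) (N : ℕ) :
    ∑ m ∈ Finset.range N, (Φ (g^[m] x) - c * Metric.infDist (g^[m] x) (P : Set X) ^ α - β) ≤
      H * ((2 * K) ^ α * (2 / (1 - (lam⁻¹) ^ α)) * ρ ^ α) + P.card * (2 * κ) +
      2 * (V * ρ ^ α + w) + 2 * κ + (v (g^[N] x) - v x) := by
  obtain ⟨hβQ, hPsum⟩ := hP.sum_range_sub_average_le hκ hβ hcob
  rw [abs_le] at hβQ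
  have hδ0 : 0 ≤ δ := hρ.trans hρδ
  have hq1 : (lam⁻¹) ^ α < 1 :=
    Real.rpow_lt_one (by positivity) (inv_lt_one_of_one_lt₀ hlam) hα
  have hq2 : 0 ≤ 2 / (1 - (lam⁻¹) ^ α) := div_nonneg zero_le_two (by linarith)
  have hgS : ∀ m, g^[m] x ∈ S := fun m => hS.iterate m hx
  have hpen : ∀ z : X, 0 ≤ c * Metric.infDist z (P : Set X) ^ α := fun z =>
    mul_nonneg hc (Real.rpow_nonneg Metric.infDist_nonneg _)
  have hr : ∀ m, Φ (g^[m] x) - c * Metric.infDist (g^[m] x) (P : Set X) ^ α - β +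
      (v (g^[m] x) - v (g^[m + 1] x)) ≤
      2 * κ - c * Metric.infDist (g^[m] x) (P : Set X) ^ α := by
    intro m
    have := hsub _ (hgS m)
    rw [← Function.iterate_succ_apply' g m x] at this
    linarith [hβQ.1]
  have hE0 : 0 ≤ H * ((2 * K) ^ α * (2 / (1 - (lam⁻¹) ^ α)) * ρ ^ α) + P.card * (2 * κ) +
      2 * (V * ρ ^ α + w) := by positivity
  have main := sum_range_le_of_excursions (a := fun m => Metric.infDist (g^[m] x) (P : Set X))
    (r := fun m => Φ (g^[m] x) - c * Metric.infDist (g^[m] x) (P : Set X) ^ α - β +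
      (v (g^[m] x) - v (g^[m + 1] x))) (e := 2 * κ) (G := c * δ ^ α - 2 * κ) (by linarith) hE0
    hρδ hδc (fun m => (hr m).trans (by linarith [hpen (g^[m] x)]))
    (fun m hm => by
      have : c * ρ ^ α ≤ c * Metric.infDist (g^[m] x) (P : Set X) ^ α := by gcongr
      linarith [hr m])
    (fun m hm => by
      have : c * δ ^ α ≤ c * Metric.infDist (g^[m] x) (P : Set X) ^ α := by gcongr
      linarith [hr m])
    (fun s n hδ hs hn => by
      obtain ⟨y, hy, hxy, hxy0, hxyn⟩ := exists_shadowed_orbit (x := g^[s] x) (n := n) hP.nonempty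
        (fun _ => hP.map_mem) hρδ hΛ0 hΛ hsep
        (fun m hm => by
          rw [← Function.iterate_add_apply, add_comm]
          exact hδ m hm) hs
        (by rw [← Function.iterate_add_apply, add_comm]; exact hn)
      set z := g^[s] x with hz
      have hzm : ∀ m, g^[s + m] x = g^[m] z := fun m => by
        rw [hz, ← Function.iterate_add_apply, add_comm]
      have hzS : ∀ m, g^[m] z ∈ S := fun m => hS.iterate m (hgS s)
      have hyS : ∀ m, g^[m] y ∈ S := fun m => hS.iterate m (hPS y hy)
      have hsumdist := sum_rpow_le_of_hyperbolic (K := 2 * K) hα (by positivity) hlam hρ (n := n)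
        (a := fun m => dist (g^[m] z) (g^[m] y)) (fun _ => dist_nonneg)
        (fun m hm => (hhyp z (hgS s) y (hPS y hy) n hxy m hm).trans (by
          have : dist z y + dist (g^[n] z) (g^[n] y) ≤ 2 * ρ := by linarith
          calc _ ≤ K * (lam ^ min m (n - m))⁻¹ * (2 * ρ) := by gcongr
            _ = _ := by ring))
      have hv0 : |v z - v y| ≤ V * ρ ^ α + w :=
        (hv z (hgS s) y (hPS y hy)).trans (by gcongr)
      have hvn : |v (g^[n] z) - v (g^[n] y)| ≤ V * ρ ^ α + w :=
        (hv _ (hzS n) _ (hyS n)).trans (by gcongr)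
      have hcobz := sum_range_coboundary (g := g) v z n
      have hcoby := sum_range_coboundary (g := g) v y n
      have hPy := hPsum y hy n
      have hterm : ∀ m ∈ Finset.range n,
          Φ (g^[s + m] x) - c * Metric.infDist (g^[s + m] x) (P : Set X) ^ α - β +
            (v (g^[s + m] x) - v (g^[s + m + 1] x)) ≤
          H * dist (g^[m] z) (g^[m] y) ^ α +
            (Φ (g^[m] y) + v (g^[m] y) - v (g^[m + 1] y) - β) +
            (v (g^[m] z) - v (g^[m + 1] z)) - (v (g^[m] y) - v (g^[m + 1] y)) := by
        intro m _
        rw [add_assoc s m 1, hzm, hzm]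
        have h1 := (abs_le.1 (hΦ (g^[m] z) trivial (g^[m] y) trivial)).2
        linarith [hpen (g^[m] z)]
      refine (Finset.sum_le_sum hterm).trans ?_
      rw [Finset.sum_sub_distrib, Finset.sum_add_distrib, Finset.sum_add_distrib,
        ← Finset.mul_sum, hcobz, hcoby]
      rw [abs_le] at hv0 hvn
      have hHd := mul_le_mul_of_nonneg_left hsumdist hH
      linarith [hv0.2, hvn.1]) N
  rw [Finset.sum_add_distrib, sum_range_coboundary] at main
  linarith

theorem IsPeriodicOrbit.maxMeasures_penalised_eq [CompactSpace X] [MeasurableSpace X]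
    [BorelSpace X] {g : X → X} {P : Finset X} (hP : IsPeriodicOrbit g P) (hg : Continuous g)
    {α c β D : ℝ} (hα : 0 < α) (hc : 0 < c) {Φ : X → ℝ} (hΦ : Continuous Φ)
    (hβ : β = (P.card : ℝ)⁻¹ * ∑ y ∈ P, Φ y)
    (hD : ∀ x ∈ nonwanderingSet g, ∀ N : ℕ, ∑ m ∈ Finset.range N,
      (Φ (g^[m] x) - c * Metric.infDist (g^[m] x) (P : Set X) ^ α - β) ≤ D) :
    maxMeasures g (fun x => Φ x - 2 * c * Metric.infDist x (P : Set X) ^ α) =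
      {orbitMeasure P} := by
  have hdist : Continuous fun x => Metric.infDist x (P : Set X) ^ α :=
    (Metric.continuous_infDist_pt _).rpow_const fun _ => Or.inr hα.le
  have hPβ : ∫ x, (Φ x - 2 * c * Metric.infDist x (P : Set X) ^ α) ∂(orbitMeasure P) = β := by
    rw [integral_orbitMeasure, hβ]
    congr 1
    refine Finset.sum_congr rfl fun y hy => ?_
    rw [Metric.infDist_zero_of_mem (Finset.mem_coe.2 hy), Real.zero_rpow hα.ne']
    ring
  have hinteg : ∀ μ : Measure X, IsInvProb g μ → ∀ θ : X → ℝ, Continuous θ → Integrable θ μ :=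
    fun μ hμ θ hθ => by
      have := hμ.1
      exact hθ.integrable_of_hasCompactSupport (HasCompactSupport.of_compactSpace θ)
  have hμle : ∀ μ : Measure X, IsInvProb g μ →
      ∫ x, (Φ x - 2 * c * Metric.infDist x (P : Set X) ^ α) ∂μ ≤
        β - c * ∫ x, Metric.infDist x (P : Set X) ^ α ∂μ := by
    intro μ hμ
    have := hμ.1
    have h1 := hμ.integral_nonpos_of_birkhoffSum_le hg.measurable
      (θ := fun x => Φ x - c * Metric.infDist x (P : Set X) ^ α - β) (D := D)
      (hinteg μ hμ _ (by fun_prop))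
      ((hμ.ae_mem_nonwanderingSet hg.measurable).mono hD)
    rw [integral_sub (hinteg μ hμ _ (by fun_prop)) (integrable_const _),
      integral_sub (hinteg μ hμ _ hΦ) (hinteg μ hμ _ (by fun_prop)), integral_const_mul] at h1
    rw [integral_sub (hinteg μ hμ _ hΦ) (hinteg μ hμ _ (by fun_prop)), integral_const_mul]
    simp only [integral_const, probReal_univ, one_smul] at h1
    linarith
  have hnonneg : ∀ μ : Measure X, 0 ≤ ∫ x, Metric.infDist x (P : Set X) ^ α ∂μ := fun μ =>
    integral_nonneg fun x => Real.rpow_nonneg Metric.infDist_nonneg _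
  refine maxMeasures_eq_of_integral_le hP hg.measurable (fun μ hμ => ?_) (fun μ hμ h => ?_)
  · rw [hPβ]
    linarith [hμle μ hμ, mul_nonneg hc.le (hnonneg μ)]
  · rw [hPβ] at h
    have h0 : c * ∫ x, Metric.infDist x (P : Set X) ^ α ∂μ ≤ 0 := by linarith [hμle μ hμ]
    have h1 : ∫ x, Metric.infDist x (P : Set X) ^ α ∂μ = 0 :=
      le_antisymm (nonpos_of_mul_nonpos_right h0 hc) (hnonneg μ)
    rw [integral_eq_zero_iff_of_nonneg (fun x => Real.rpow_nonneg Metric.infDist_nonneg _)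
      (hinteg μ hμ _ hdist)] at h1
    filter_upwards [h1] with x hx
    have hx0 : Metric.infDist x (P : Set X) = 0 := by
      by_contra hne
      exact hne ((Real.rpow_eq_zero Metric.infDist_nonneg hα.ne').1 hx)
    exact (P.finite_toSet.isClosed.mem_iff_infDist_zero hP.nonempty).2 hx0

end Perturbation

section MainTheorem

variable {X : Type*} [MetricSpace X]

theorem Finset.exists_pos_le_dist (O : Finset X) :
    ∃ σ > (0 : ℝ), ∀ x ∈ O, ∀ y ∈ O, x ≠ y → σ ≤ dist x y := by
  classical
  rcases O.offDiag.eq_empty_or_nonempty with h | h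
  · refine ⟨1, one_pos, fun x hx y hy hxy => ?_⟩
    have : (x, y) ∈ O.offDiag := Finset.mem_offDiag.2 ⟨hx, hy, hxy⟩
    simp [h] at this
  · obtain ⟨p, hp, hmin⟩ := O.offDiag.exists_min_image (fun p => dist p.1 p.2) h
    refine ⟨dist p.1 p.2, dist_pos.2 (Finset.mem_offDiag.1 hp).2.2, fun x hx y hy hxy => ?_⟩
    exact hmin (x, y) (Finset.mem_offDiag.2 ⟨hx, hy, hxy⟩)

/-- In a system with hyperbolic estimates, periodic orbits which stay close coincide. -/
theorem eq_of_periodic_of_hyperbolic {f : X → X} {S : Set X} {K δ lam : ℝ} (hlam : 1 < lam)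
    (hhyp : ∀ x ∈ S, ∀ y ∈ S, ∀ n : ℕ, (∀ m ≤ n, dist (f^[m] x) (f^[m] y) < δ) →
      ∀ m ≤ n, dist (f^[m] x) (f^[m] y) ≤
        K * (lam ^ min m (n - m))⁻¹ * (dist x y + dist (f^[n] x) (f^[n] y)))
    {x y : X} (hx : x ∈ S) (hy : y ∈ S) (hclose : ∀ m, dist (f^[m] x) (f^[m] y) < δ) {p : ℕ}
    (hp : 0 < p) (hfx : f^[p] x = x) (hfy : f^[p] y = y) : x = y := by
  have hmul : ∀ k, ∀ z, f^[p] z = z → f^[k * p] z = z := by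
    intro k z hz
    rw [mul_comm, Function.iterate_mul]
    exact Function.iterate_fixed hz k
  have hbound : ∀ k : ℕ, dist x y ≤ K * ((lam⁻¹) ^ (k * p)) * (dist x y + dist x y) := by
    intro k
    have := hhyp x hx y hy (2 * k * p) (fun m _ => hclose m) (k * p) (by nlinarith)
    rwa [hmul k x hfx, hmul k y hfy, hmul _ x hfx, hmul _ y hfy,
      show 2 * k * p - k * p = k * p by rw [mul_assoc, two_mul, Nat.add_sub_cancel], min_self,
      ← inv_pow] at this
  have hlim : Tendsto (fun k : ℕ => K * ((lam⁻¹) ^ (k * p)) * (dist x y + dist x y)) atTop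
      (nhds 0) := by
    have h1 : Tendsto (fun k : ℕ => (lam⁻¹) ^ (k * p)) atTop (nhds 0) :=
      (tendsto_pow_atTop_nhds_zero_of_lt_one (by positivity)
        (inv_lt_one_of_one_lt₀ hlam)).comp (tendsto_id.atTop_mul_const' hp)
    simpa using (h1.const_mul K).mul_const (dist x y + dist x y)
  exact dist_le_zero.1 (ge_of_tendsto' hlim hbound)

variable [DecidableEq X] [CompactSpace X] [MeasurableSpace X] [BorelSpace X]

theorem maxMeasures_perturbed_eq {f g h i : X → X} {O : Finset X} (hO : IsPeriodicOrbit f O)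
    (hg : Continuous g) (hhS : MapsTo h (nonwanderingSet f) (nonwanderingSet g))
    (hiS : MapsTo i (nonwanderingSet g) (nonwanderingSet f))
    (hh : ∀ x ∈ nonwanderingSet f, h (f x) = g (h x))
    (hi : ∀ x ∈ nonwanderingSet g, i (g x) = f (i x)) (hih : ∀ x ∈ O, i (h x) = x)
    {α Λ δ σ K lam L C d : ℝ} (hα0 : 0 < α) (hα1 : α ≤ 1)
    (hdi : ∀ x ∈ nonwanderingSet g, dist (i x) x ≤ d)
    (hdh : ∀ x ∈ nonwanderingSet f, dist (h x) x ≤ d) (hd : 0 < d) (hδ : 0 < δ) (hΛ0 : 0 ≤ Λ)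
    (hΛ : ∀ x y, dist (g x) (g y) ≤ Λ * dist x y)
    (hσ : ∀ x ∈ O, ∀ y ∈ O, x ≠ y → σ ≤ dist x y)
    (hσδ1 : Λ * δ + δ ≤ σ - 2 * d) (hσδ2 : 2 * δ ≤ σ - 2 * d)
    (hK : 0 < K) (hlam : 1 < lam)
    (hhyp : ∀ x ∈ nonwanderingSet g, ∀ y ∈ nonwanderingSet g, ∀ n : ℕ,
      (∀ m ≤ n, dist (g^[m] x) (g^[m] y) < δ) → ∀ m ≤ n, dist (g^[m] x) (g^[m] y) ≤
        K * (lam ^ min m (n - m))⁻¹ * (dist x y + dist (g^[n] x) (g^[n] y)))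
    (hL : 0 < L) (hC1 : 1 ≤ C)
    (hC : 8 * ((2 * K) ^ α * (2 / (1 - (lam⁻¹) ^ α))) + 4 * O.card + 12 * L + 8 ≤ C * δ ^ α)
    (hdC : 5 * C * d ^ (α / 2) ≤ 1)
    {φ ξ u : X → ℝ} {A : ℝ} (hA : 0 < A) (hφ : HolderBoundOn A α Set.univ φ)
    (hξ : HolderBoundOn (5 * C * A * d ^ (α / 2)) α Set.univ ξ) (hξ0 : ∀ x, |ξ x| ≤ A * d ^ α)
    (hQ : ∫ x, φ x ∂(orbitMeasure O) = maxErgAvg f φ)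
    (hu : ∀ z ∈ nonwanderingSet f, φ z + u z - u (f z) ≤ maxErgAvg f φ)
    (huL : HolderBoundOn (L * A) α (nonwanderingSet f) u) :
    maxMeasures g (fun x => φ x - 2 * C * A * d ^ (α / 2) *
      Metric.infDist x (↑(O.image h) : Set X) ^ α + ξ x) = {orbitMeasure (O.image h)} := by
  set η := d ^ (α / 2) with hη
  have hη0 : 0 < η := Real.rpow_pos_of_pos hd _
  have hη2 : d ^ α = η ^ 2 := by
    rw [hη, ← Real.rpow_natCast, ← Real.rpow_mul hd.le]
    norm_num
  have hC0 : 0 < C := one_pos.trans_le hC1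
  have hη1 : η ≤ 1 := by nlinarith
  have hOΩ : ∀ x ∈ O, x ∈ nonwanderingSet f := fun x => hO.subset_nonwanderingSet
  have hP : IsPeriodicOrbit g (O.image h) := hO.image_of_semiconj fun x hx => hh x (hOΩ x hx)
  have hcard : ((O.image h).card : ℝ) ≤ O.card := by exact_mod_cast Finset.card_image_le
  have hq1 : (lam⁻¹) ^ α < 1 :=
    Real.rpow_lt_one (by positivity) (inv_lt_one_of_one_lt₀ hlam) hα0
  set M := (2 * K) ^ α * (2 / (1 - (lam⁻¹) ^ α)) with hM
  have hM0 : 0 ≤ M := mul_nonneg (by positivity) (div_nonneg zero_le_two (by linarith))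
  set ρ := (4 * η / C) ^ α⁻¹ with hρ
  have hρα : ρ ^ α = 4 * η / C := Real.rpow_inv_rpow (by positivity) hα0.ne'
  have hφc := hφ.continuous hα0
  have hξc := hξ.continuous hα0
  have hOcob : ∀ z ∈ O, φ z + u z - u (f z) = maxErgAvg f φ := by
    have hc : (0 : ℝ) < O.card := by exact_mod_cast hO.nonempty.card_pos
    have hsum : ∑ z ∈ O, (φ z + u z - u (f z)) = ∑ _z ∈ O, maxErgAvg f φ := by
      rw [Finset.sum_sub_distrib, Finset.sum_add_distrib, hO.sum_comp u, ← hQ,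
        integral_orbitMeasure]
      simp only [Finset.sum_const, nsmul_eq_mul]
      field_simp
      ring
    exact (Finset.sum_eq_sum_iff_of_le fun z hz => hu z (hOΩ z hz)).1 hsum
  have hφi : ∀ x ∈ nonwanderingSet g, |φ x - φ (i x)| ≤ A * η ^ 2 := by
    intro x hx
    rw [← hη2]
    refine (hφ x trivial (i x) trivial).trans ?_
    gcongr
    rw [dist_comm]
    exact hdi x hx
  set Φ : X → ℝ := fun x => φ x + ξ x with hΦ
  have hΦH : HolderBoundOn (2 * A) α Set.univ Φ := by
    intro x _ y _
    have h1 := hφ x trivial y trivial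
    have h2 := hξ x trivial y trivial
    have h3 : 0 ≤ dist x y ^ α := Real.rpow_nonneg dist_nonneg _
    have h4 : 5 * C * A * η * dist x y ^ α ≤ A * dist x y ^ α := by
      gcongr
      nlinarith
    calc |Φ x - Φ y| = |(φ x - φ y) + (ξ x - ξ y)| := by rw [hΦ]; congr 1; ring
      _ ≤ |φ x - φ y| + |ξ x - ξ y| := abs_add_le _ _
      _ ≤ 2 * A * dist x y ^ α := by linarith
  have hv : ∀ x ∈ nonwanderingSet g, ∀ y ∈ nonwanderingSet g,
      |u (i x) - u (i y)| ≤ L * A * dist x y ^ α + 2 * (L * A * η ^ 2) := by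
    intro x hx y hy
    have h1 : dist (i x) (i y) ≤ dist x y + (d + d) := by
      have := dist_triangle4 (i x) x y (i y)
      rw [dist_comm y (i y)] at this
      linarith [hdi x hx, hdi y hy]
    have h2 : dist (i x) (i y) ^ α ≤ dist x y ^ α + 2 * η ^ 2 := by
      calc dist (i x) (i y) ^ α ≤ (dist x y + (d + d)) ^ α := by gcongr
        _ ≤ dist x y ^ α + (d + d) ^ α :=
          Real.rpow_add_le_add_rpow dist_nonneg (by linarith) hα0.le hα1
        _ ≤ dist x y ^ α + (d ^ α + d ^ α) := by
          gcongr
          exact Real.rpow_add_le_add_rpow hd.le hd.le hα0.le hα1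
        _ = _ := by rw [hη2]; ring
    calc |u (i x) - u (i y)| ≤ L * A * dist (i x) (i y) ^ α :=
          huL _ (hiS hx) _ (hiS hy)
      _ ≤ L * A * (dist x y ^ α + 2 * η ^ 2) := by gcongr
      _ = _ := by ring
  have hsub : ∀ x ∈ nonwanderingSet g,
      Φ x + u (i x) - u (i (g x)) ≤ maxErgAvg f φ + 2 * A * η ^ 2 := by
    intro x hx
    have h1 := hu (i x) (hiS hx)
    rw [← hi x hx] at h1
    have h2 := (abs_le.1 (hφi x hx)).2
    have h3 := (abs_le.1 (hξ0 x)).2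
    rw [hη2] at h3
    simp only [hΦ]
    linarith
  have hcob : ∀ y ∈ O.image h,
      |Φ y + u (i y) - u (i (g y)) - maxErgAvg f φ| ≤ 2 * A * η ^ 2 := by
    intro y hy
    obtain ⟨z, hz, rfl⟩ := Finset.mem_image.1 hy
    have hzΩ := hhS (hOΩ z hz)
    have h1 := hOcob z hz
    have h2 := abs_le.1 (hφi _ hzΩ)
    have h3 := abs_le.1 (hξ0 (h z))
    rw [hη2] at h3
    rw [hi _ hzΩ, hih z hz]
    rw [hih z hz] at h2
    simp only [hΦ]
    rw [abs_le]
    constructor <;> linarith [h2.1, h2.2, h3.1, h3.2]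
  have hsep : ∀ y ∈ O.image h, ∀ y' ∈ O.image h, y ≠ y' →
      Λ * δ + δ ≤ dist y y' ∧ 2 * δ ≤ dist y y' := by
    intro y hy y' hy' hne
    obtain ⟨z, hz, rfl⟩ := Finset.mem_image.1 hy
    obtain ⟨z', hz', rfl⟩ := Finset.mem_image.1 hy'
    have h1 := hσ z hz z' hz' fun h => hne (by rw [h])
    have h2 := dist_triangle4 z (h z) (h z') z'
    rw [dist_comm z (h z)] at h2
    have h3 := hdh z (hOΩ z hz)
    have h4 := hdh z' (hOΩ z' hz')
    constructor <;> linarith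
  have hδα : 0 < δ ^ α := Real.rpow_pos_of_pos hδ _
  have hρδ : ρ ≤ δ := by
    rw [← Real.rpow_le_rpow_iff (by positivity) hδ.le hα0, hρα, div_le_iff₀ hC0]
    have : (0 : ℝ) ≤ O.card := Nat.cast_nonneg _
    nlinarith
  have hg' : MapsTo g (nonwanderingSet g) (nonwanderingSet g) := mapsTo_nonwanderingSet hg
  have hρc : 2 * (2 * A * η ^ 2) ≤ C * A * η * ρ ^ α := by
    rw [hρα]
    apply le_of_eq
    field_simp
    ring
  have hdivC : 4 * η / C ≤ 4 * η := div_le_self (by positivity) hC1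
  have hδc : 2 * A * (M * ρ ^ α) + (O.image h).card * (2 * (2 * A * η ^ 2)) +
      2 * (L * A * ρ ^ α + 2 * (L * A * η ^ 2)) + 2 * (2 * A * η ^ 2) ≤
      C * A * η * δ ^ α - 2 * (2 * A * η ^ 2) := by
    rw [hρα]
    have hηη : η ^ 2 ≤ η := by nlinarith
    calc 2 * A * (M * (4 * η / C)) + (O.image h).card * (2 * (2 * A * η ^ 2)) +
          2 * (L * A * (4 * η / C) + 2 * (L * A * η ^ 2)) + 2 * (2 * A * η ^ 2)
        ≤ 2 * A * (M * (4 * η)) + O.card * (2 * (2 * A * η)) +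
          2 * (L * A * (4 * η) + 2 * (L * A * η)) + 2 * (2 * A * η) := by gcongr
      _ = A * η * (8 * M + 4 * O.card + 12 * L + 8) - 2 * (2 * A * η) := by ring
      _ ≤ A * η * (C * δ ^ α) - 2 * (2 * A * η ^ 2) := by gcongr
      _ = _ := by ring
  have hmain := hP.maxMeasures_penalised_eq hg hα0 (c := C * A * η) (by positivity)
    (Φ := Φ) (hφc.add hξc) rfl
    (D := 2 * A * (M * ρ ^ α) + (O.image h).card * (2 * (2 * A * η ^ 2)) +
      2 * (L * A * ρ ^ α + 2 * (L * A * η ^ 2)) + 2 * (2 * A * η ^ 2) +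
      (L * A * Metric.diam (Set.univ : Set X) ^ α + 2 * (L * A * η ^ 2)))
    (fun x hx N => by
      refine (hP.sum_range_penalised_le (fun y => hP.subset_nonwanderingSet) hg' hα0
        (by positivity) hρδ hΛ0 hΛ hsep hK hlam hhyp (by positivity) (by positivity)
        (by positivity) (by positivity) (by positivity) hΦH hv hsub hcob rfl hρc hδc hx N).trans ?_
      have h1 := (abs_le.1 (hv _ (hg'.iterate N hx) x hx)).2
      have h2 : dist (g^[N] x) x ^ α ≤ Metric.diam (Set.univ : Set X) ^ α := by
        gcongr
        exact Metric.dist_le_diam_of_mem isCompact_univ.isBounded trivial trivial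
      have h3 := mul_le_mul_of_nonneg_left h2 (mul_pos hL hA).le
      linarith)
  rw [← hmain]
  congr 1
  funext x
  simp only [hΦ]
  ring

end MainTheorem

/-- **Joint perturbation for Hölder potentials.** -/
theorem joint_perturbation_for_holder_potentials
    {X : Type*} [MetricSpace X] [CompactSpace X] [MeasurableSpace X] [BorelSpace X]
    [DecidableEq X] {F : Type*} [TopologicalSpace F]
    (ι : F → X → X) (hlip : ∀ g : F, ∃ K : NNReal, LipschitzWith K (ι g))
    (α : ℝ) (hα0 : 0 < α) (hα1 : α ≤ 1)
    (f : F) (hsh : StablyHyperbolic ι f)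
    (O : Finset X) (hO : IsPeriodicOrbit (ι f) O) :
    ∃ U ∈ nhds f, ∃ C > (0:ℝ), ∀ g ∈ U,
      ∃ h i : X → X,
        Set.MapsTo h (nonwanderingSet (ι f)) (nonwanderingSet (ι g)) ∧
        Set.MapsTo i (nonwanderingSet (ι g)) (nonwanderingSet (ι f)) ∧
        (∀ x ∈ nonwanderingSet (ι f), h (ι f x) = ι g (h x)) ∧
        (∀ x ∈ nonwanderingSet (ι g), i (ι g x) = ι f (i x)) ∧
        (∀ φ : X → ℝ, IsHolderOn α Set.univ φ → (∃ x y, φ x ≠ φ y) →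
          maxMeasures (ι f) φ = {orbitMeasure O} →
          ∀ ξ : X → ℝ, IsHolderOn α Set.univ ξ →
            HolderBoundOn
              (5 * C * holderSemiOn α Set.univ φ *
                (max (supDistOn (nonwanderingSet (ι f)) h)
                  (supDistOn (nonwanderingSet (ι g)) i)) ^ (α / 2))
              α Set.univ ξ →
            (∀ x, |ξ x| ≤ holderSemiOn α Set.univ φ *
              (max (supDistOn (nonwanderingSet (ι f)) h)
                (supDistOn (nonwanderingSet (ι g)) i)) ^ α) →
            maxMeasures (ι g)
              (fun x => φ x -
                2 * C * holderSemiOn α Set.univ φ *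
                  (max (supDistOn (nonwanderingSet (ι f)) h)
                    (supDistOn (nonwanderingSet (ι g)) i)) ^ (α / 2) *
                  Metric.infDist x (↑(O.image h) : Set X) ^ α + ξ x)
              = {orbitMeasure (O.image h)}) := by
  obtain ⟨hIS, ⟨U₁, hU₁, K, hK, δ₀, hδ₀, lam, hlam, hhyp⟩, hML⟩ := hsh
  obtain ⟨L, hL, hMane⟩ := hML α hα0 hα1
  obtain ⟨σ, hσ0, hσ⟩ := Finset.exists_pos_le_dist O
  have hcont : ∀ g, Continuous (ι g) := fun g => (hlip g).choose_spec.continuous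
  set Λ := 2 * lipConst (ι f) with hΛ
  have hΛ0 : 0 ≤ Λ := mul_nonneg zero_le_two (Real.sInf_nonneg fun _ h => h.1)
  set δ := min δ₀ (σ / (2 * (Λ + 2))) with hδ
  have hδ0 : 0 < δ := lt_min hδ₀ (by positivity)
  have hδσ : δ * (2 * (Λ + 2)) ≤ σ := (le_div_iff₀ (by positivity)).1 (min_le_right _ _)
  have hδα : 0 < δ ^ α := Real.rpow_pos_of_pos hδ0 _
  set M := 8 * ((2 * K) ^ α * (2 / (1 - (lam⁻¹) ^ α))) + 4 * O.card + 12 * L + 8 with hM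
  set C := max 1 (M / δ ^ α) with hC
  have hC1 : 1 ≤ C := le_max_left _ _
  have hC0 : 0 < C := one_pos.trans_le hC1
  have hCM : M ≤ C * δ ^ α := (div_le_iff₀ hδα).1 (le_max_right _ _)
  set ε := min (min (δ₀ / 2) (σ / 4)) ((1 / (5 * C)) ^ (α / 2)⁻¹) with hε
  have hε0 : 0 < ε := lt_min (lt_min (by positivity) (by positivity)) (by positivity)
  have hεδ : ε ≤ δ₀ / 2 := (min_le_left _ _).trans (min_le_left _ _)
  have hεσ : ε ≤ σ / 4 := (min_le_left _ _).trans (min_le_right _ _)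
  have hεC : ε ^ (α / 2) ≤ 1 / (5 * C) := by
    calc ε ^ (α / 2) ≤ ((1 / (5 * C)) ^ (α / 2)⁻¹) ^ (α / 2) := by
          gcongr
          exact min_le_right _ _
      _ = 1 / (5 * C) := Real.rpow_inv_rpow (by positivity) (by positivity)
  obtain ⟨U₂, hU₂, hinteg⟩ := hIS ε hε0
  refine ⟨U₁ ∩ U₂, Filter.inter_mem hU₁ hU₂, C, hC0, fun g hg => ?_⟩
  obtain ⟨hlipg, h, i, hhS, hiS, hh, hi, hhε, hiε⟩ := hinteg g hg.2
  refine ⟨h, i, hhS, hiS, hh, hi, fun φ hφ hne hmax ξ _ hξ hξ0 => ?_⟩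
  set d := max (supDistOn (nonwanderingSet (ι f)) h) (supDistOn (nonwanderingSet (ι g)) i) with hd
  have hd0 : 0 ≤ d := (supDistOn_nonneg _ _).trans (le_max_left _ _)
  have hdε : d ≤ ε := max_le (supDistOn_le hε0.le hhε) (supDistOn_le hε0.le hiε)
  have hdh : ∀ x ∈ nonwanderingSet (ι f), dist (h x) x ≤ d := fun x hx =>
    (dist_le_supDistOn hhε hx).trans (le_max_left _ _)
  have hdi : ∀ x ∈ nonwanderingSet (ι g), dist (i x) x ≤ d := fun x hx =>
    (dist_le_supDistOn hiε hx).trans (le_max_right _ _)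
  have hOΩ : ∀ x ∈ O, x ∈ nonwanderingSet (ι f) := fun x => hO.subset_nonwanderingSet
  rcases hd0.eq_or_lt with hd00 | hdpos
  · have hhid : ∀ x ∈ nonwanderingSet (ι f), h x = x := fun x hx =>
      dist_le_zero.1 (hd00 ▸ hdh x hx)
    have hiid : ∀ x ∈ nonwanderingSet (ι g), i x = x := fun x hx =>
      dist_le_zero.1 (hd00 ▸ hdi x hx)
    have hΩ : nonwanderingSet (ι f) = nonwanderingSet (ι g) :=
      Set.Subset.antisymm (fun x hx => hhid x hx ▸ hhS hx) (fun x hx => hiid x hx ▸ hiS hx)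
    have hOh : O.image h = O := by
      rw [Finset.image_congr (g := id) fun x hx => hhid x (hOΩ x hx), Finset.image_id]
    have hψ : (fun x => φ x - 2 * C * holderSemiOn α Set.univ φ * d ^ (α / 2) *
        Metric.infDist x (↑(O.image h) : Set X) ^ α + ξ x) = φ := by
      funext x
      have := hξ0 x
      rw [← hd00, Real.zero_rpow hα0.ne', mul_zero, abs_nonpos_iff] at this
      rw [this, ← hd00, Real.zero_rpow (by positivity)]
      ring
    rw [hψ, hOh, maxMeasures_congr (hcont f).measurable (hcont g).measurable hΩ (fun x hx => ?_),
      hmax]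
    rw [← hhid (ι f x) (mapsTo_nonwanderingSet (hcont f) hx), hh x hx, hhid x hx]
  · obtain ⟨u, hu, huL⟩ := hMane φ hφ
    have hmem : orbitMeasure O ∈ maxMeasures (ι f) φ := by rw [hmax]; rfl
    have hih : ∀ x ∈ O, i (h x) = x := by
      intro x hx
      have hiter : ∀ m, (ι f)^[m] (i (h x)) = i (h ((ι f)^[m] x)) := fun m => by
        rw [iterate_semiconjOn (mapsTo_nonwanderingSet (hcont f)) hh (hOΩ x hx),
          iterate_semiconjOn (mapsTo_nonwanderingSet (hcont g)) hi (hhS (hOΩ x hx))]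
      refine eq_of_periodic_of_hyperbolic hlam (hhyp f (mem_of_mem_nhds hU₁))
        (hiS (hhS (hOΩ x hx))) (hOΩ x hx) (fun m => ?_) hO.nonempty.card_pos ?_
        (hO.iterate_card hx)
      · rw [hiter]
        have hxm := hOΩ _ (hO.iterate_mem hx m)
        calc _ ≤ dist (i (h ((ι f)^[m] x))) (h ((ι f)^[m] x)) +
              dist (h ((ι f)^[m] x)) ((ι f)^[m] x) := dist_triangle _ _ _
          _ < ε + ε := add_lt_add (hiε _ (hhS hxm)) (hhε _ hxm)
          _ ≤ δ₀ := by linarith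
      · rw [hiter, hO.iterate_card hx]
    refine maxMeasures_perturbed_eq hO (hcont g) hhS hiS hh hi hih hα0 hα1 hdi hdh hdpos hδ0 hΛ0
      (fun x y => ?_) hσ ?_ ?_ hK hlam (fun x hx y hy n hn => ?_) hL hC1 hCM ?_
      (hφ.holderSemiOn_pos hne) hφ.holderBoundOn_univ hξ hξ0 hmem.2 hu huL
    · obtain ⟨K', hK'⟩ := hlip g
      exact (dist_le_lipConst_mul hK' x y).trans (by gcongr)
    · linarith
    · nlinarith
    · exact hhyp g hg.1 x hx y hy n fun m hm => (hn m hm).trans_le (min_le_left _ _)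
    · calc 5 * C * d ^ (α / 2) ≤ 5 * C * ε ^ (α / 2) := by gcongr
        _ ≤ 5 * C * (1 / (5 * C)) := by gcongr
        _ = 1 := by field_simp
end

section
/- Let r ∈ ℕ, a < b, τ > 0, and let f : [a,b] → ℝ be r-times continuously differentiable with f'(b) > 0 and f(b) < b − τ. For k ∈ ℝ define h_k : [b,+∞) → ℝ by h_k(x) := Σ_{i=0}^{r} (f^{(i)}(b)/i!)·(x−b)^i + (k/(r+1)!)·(x−b)^{r+1}. Then there exist l ∈ ℝ and b₁ > b such that h_l'(x) > 0 for all x ∈ [b,+∞), h_l'(x) > 2 for all x ∈ (b₁,+∞), and h_l(b₁) = b − τ. -/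
open Set

/-- The one-sided Taylor-polynomial extension of `f` beyond `b`, with an
adjustable coefficient `k` on the `(x - b)^(r+1)` term:
`h_k(x) = ∑_{i=0}^r f⁽ⁱ⁾(b)/i! (x-b)^i + k/(r+1)! (x-b)^(r+1)`. -/
noncomputable def taylorExt (r : ℕ) (f : ℝ → ℝ) (s : Set ℝ) (b k x : ℝ) : ℝ :=
  (∑ i ∈ Finset.range (r + 1),
    iteratedDerivWithin i f s b / (Nat.factorial i : ℝ) * (x - b) ^ i) +
  k / (Nat.factorial (r + 1) : ℝ) * (x - b) ^ (r + 1)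

/-- Given `c 1 > 0` and `d > 0`, the polynomial `∑_{i=1}^r c i y^i + L y^(r+1)` takes the value `d`
at some `δ > 0`, with positive derivative on `[0, ∞)` and derivative `> 2` beyond `δ`, for a
suitable leading coefficient `L`. -/
theorem exists_leading_coefficient (r : ℕ) (hr : 1 ≤ r) (c : ℕ → ℝ) (d : ℝ)
    (hc : 0 < c 1) (hd : 0 < d) :
    ∃ L δ : ℝ, 0 < δ ∧
      (∀ y, 0 ≤ y →
        0 < ∑ i ∈ Finset.range r, c (i + 1) * (i + 1) * y ^ i + L * (r + 1) * y ^ r) ∧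
      (∀ y, δ < y →
        2 < ∑ i ∈ Finset.range r, c (i + 1) * (i + 1) * y ^ i + L * (r + 1) * y ^ r) ∧
      ∑ i ∈ Finset.range r, c (i + 1) * δ ^ (i + 1) + L * δ ^ (r + 1) = d := by
  obtain ⟨C, hC⟩ : ∃ C, C = ∑ i ∈ Finset.range r, |c (i + 1)| * ((i : ℝ) + 1) := ⟨_, rfl⟩
  have hC0 : 0 ≤ C := hC ▸ Finset.sum_nonneg fun i _ => by positivity
  obtain ⟨δ, hδ, hδ1, hδc, hδd⟩ : ∃ δ : ℝ, 0 < δ ∧ δ ≤ 1 ∧ C * δ < c 1 ∧ (2 * C + 2) * δ < d := by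
    have hm : 0 < min (c 1) d := lt_min hc hd
    refine ⟨min 1 (min (c 1) d / (2 * C + 3)), by positivity, min_le_left _ _, ?_⟩
    have h1 : min 1 (min (c 1) d / (2 * C + 3)) * (2 * C + 3) ≤ min (c 1) d :=
      (le_div_iff₀ (by positivity)).1 (min_le_right _ _)
    have h2 : 0 < min 1 (min (c 1) d / (2 * C + 3)) := by positivity
    have h3 := min_le_left (c 1) d
    have h4 := min_le_right (c 1) d
    constructor <;> nlinarith [mul_nonneg hC0 h2.le]
  have hS : ∑ i ∈ Finset.range r, c (i + 1) * δ ^ (i + 1) ≤ C * δ := by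
    rw [hC, Finset.sum_mul]
    refine Finset.sum_le_sum fun i _ => ?_
    have hp : δ ^ (i + 1) ≤ δ := pow_le_of_le_one hδ.le hδ1 (Nat.succ_ne_zero i)
    calc c (i + 1) * δ ^ (i + 1) ≤ |c (i + 1)| * δ := by
          gcongr
          exact le_abs_self _
      _ ≤ |c (i + 1)| * ((i : ℝ) + 1) * δ := by
          gcongr
          exact le_mul_of_one_le_right (abs_nonneg _) (by simp)
  obtain ⟨L, hL⟩ : ∃ L : ℝ,
      L * δ ^ (r + 1) = d - ∑ i ∈ Finset.range r, c (i + 1) * δ ^ (i + 1) :=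
    ⟨_, div_mul_cancel₀ _ (by positivity)⟩
  have hLr : C + 2 < L * δ ^ r := by
    refine lt_of_mul_lt_mul_right ?_ hδ.le
    rw [mul_assoc, ← pow_succ, hL]
    linarith
  have hL0 : 0 < L := pos_of_mul_pos_left (by linarith) (by positivity : 0 ≤ δ ^ r)
  have hbig : ∀ y, δ ≤ y →
      2 < ∑ i ∈ Finset.range r, c (i + 1) * (i + 1) * y ^ i + L * (r + 1) * y ^ r := by
    intro y hy
    have hy0 : 0 < y := hδ.trans_le hy
    have ht : 1 ≤ y / δ := (one_le_div hδ).2 hy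
    have hyt : y ≤ y / δ := le_div_self hy0.le hδ hδ1
    have hsum : -(C * (y / δ) ^ r) ≤ ∑ i ∈ Finset.range r, c (i + 1) * (i + 1) * y ^ i := by
      rw [hC, Finset.sum_mul, ← Finset.sum_neg_distrib]
      refine Finset.sum_le_sum fun i hi => ?_
      have hp : y ^ i ≤ (y / δ) ^ r :=
        (pow_le_pow_left₀ hy0.le hyt i).trans
          (pow_le_pow_right₀ ht (Finset.mem_range.1 hi).le)
      have h1 : |c (i + 1)| * ((i : ℝ) + 1) * y ^ i ≤ |c (i + 1)| * ((i : ℝ) + 1) * (y / δ) ^ r := by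
        gcongr
      have h2 : -(|c (i + 1)| * (((i : ℝ) + 1) * y ^ i)) ≤ c (i + 1) * (((i : ℝ) + 1) * y ^ i) := by
        rw [← neg_mul]
        gcongr
        exact neg_abs_le _
      linarith
    have hlead : L * y ^ r = L * δ ^ r * (y / δ) ^ r := by
      rw [div_pow]
      field_simp
    have htr : 1 ≤ (y / δ) ^ r := one_le_pow₀ ht
    have hle : L * y ^ r ≤ L * (r + 1) * y ^ r := by
      have : 0 ≤ L * y ^ r * r := by positivity
      linarith
    nlinarith
  refine ⟨L, δ, hδ, fun y hy => ?_, fun y hy => hbig y hy.le, by rw [hL]; ring⟩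
  rcases le_total δ y with h | h
  · linarith [hbig y h]
  obtain ⟨m, rfl⟩ : ∃ m, r = m + 1 := ⟨r - 1, by omega⟩
  have hsum : -(C * δ) ≤ ∑ i ∈ Finset.range m, c (i + 1 + 1) * ((i + 1 : ℕ) + 1) * y ^ (i + 1) := by
    have hCm : ∑ i ∈ Finset.range m, |c (i + 1 + 1)| * (((i + 1 : ℕ) : ℝ) + 1) ≤ C := by
      rw [hC, Finset.sum_range_succ']
      exact le_add_of_nonneg_right (by positivity)
    refine (neg_le_neg (mul_le_mul_of_nonneg_right hCm hδ.le)).trans ?_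
    rw [Finset.sum_mul, ← Finset.sum_neg_distrib]
    refine Finset.sum_le_sum fun i _ => ?_
    have hp : y ^ (i + 1) ≤ δ :=
      (pow_le_of_le_one hy (h.trans hδ1) (Nat.succ_ne_zero i)).trans h
    have h1 : |c (i + 1 + 1)| * (((i + 1 : ℕ) : ℝ) + 1) * y ^ (i + 1) ≤
        |c (i + 1 + 1)| * (((i + 1 : ℕ) : ℝ) + 1) * δ := by
      gcongr
    have h2 : -(|c (i + 1 + 1)| * ((((i + 1 : ℕ) : ℝ) + 1) * y ^ (i + 1))) ≤
        c (i + 1 + 1) * ((((i + 1 : ℕ) : ℝ) + 1) * y ^ (i + 1)) := by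
      rw [← neg_mul]
      gcongr
      exact neg_abs_le _
    linarith
  have hlead : 0 ≤ L * ((m + 1 : ℕ) + 1) * y ^ (m + 1) := by positivity
  rw [Finset.sum_range_succ']
  simp only [Nat.cast_zero, zero_add, pow_zero, mul_one]
  linarith

/-- The derivative of `taylorExt`. -/
theorem hasDerivAt_taylorExt (r : ℕ) (f : ℝ → ℝ) (s : Set ℝ) (b k x : ℝ) :
    HasDerivAt (taylorExt r f s b k)
      (∑ i ∈ Finset.range r,
        iteratedDerivWithin (i + 1) f s b / (Nat.factorial (i + 1) : ℝ) * (i + 1) * (x - b) ^ i +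
      k / (Nat.factorial (r + 1) : ℝ) * (r + 1) * (x - b) ^ r) x := by
  have hpow (n : ℕ) (q : ℝ) :
      HasDerivAt (fun x => q * (x - b) ^ (n + 1)) (q * (n + 1) * (x - b) ^ n) x := by
    refine ((((hasDerivAt_id x).sub_const b).pow (n + 1)).const_mul q).congr_deriv ?_
    simp [mul_assoc]
  refine HasDerivAt.congr_of_eventuallyEq
    (((HasDerivAt.fun_sum fun i (_ : i ∈ Finset.range r) => hpow i _).add_const
      (iteratedDerivWithin 0 f s b / (Nat.factorial 0 : ℝ))).add (hpow r _)) (.of_forall fun y => ?_)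
  simp [taylorExt, Finset.sum_range_succ']

/-- **Choice of the extension coefficient (right endpoint, increasing case).**
If `f'(b) > 0` and `f(b) < b - τ`, one can choose `l` and `b₁ > b` so that
`h_l` is strictly increasing on `[b, ∞)`, has derivative `> 2` beyond `b₁`,
and `h_l(b₁) = b - τ`. -/
theorem exists_taylorExt_coefficient
    (r : ℕ) (hr : 1 ≤ r) (a b τ : ℝ) (hab : a < b) (hτ : 0 < τ)
    (f : ℝ → ℝ) (hf : ContDiffOn ℝ r f (Icc a b))
    (hfb' : 0 < derivWithin f (Icc a b) b)
    (hfb : f b < b - τ) :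
    ∃ l : ℝ, ∃ b₁ > b,
      (∀ x ∈ Ici b, 0 < deriv (taylorExt r f (Icc a b) b l) x) ∧
      (∀ x ∈ Ioi b₁, 2 < deriv (taylorExt r f (Icc a b) b l) x) ∧
      taylorExt r f (Icc a b) b l b₁ = b - τ := by
  obtain ⟨L, δ, hδ, hpos, htwo, hval⟩ := exists_leading_coefficient r hr
    (fun i => iteratedDerivWithin i f (Icc a b) b / (Nat.factorial i : ℝ)) (b - τ - f b)
    (by simpa [iteratedDerivWithin_one] using hfb') (by linarith)
  have hfac : (Nat.factorial (r + 1) : ℝ) ≠ 0 := by positivity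
  refine ⟨L * (Nat.factorial (r + 1) : ℝ), b + δ, by simpa using hδ,
    fun x hx => ?_, fun x hx => ?_, ?_⟩
  · rw [(hasDerivAt_taylorExt ..).deriv, mul_div_cancel_right₀ _ hfac]
    exact hpos _ (sub_nonneg.2 hx)
  · rw [(hasDerivAt_taylorExt ..).deriv, mul_div_cancel_right₀ _ hfac]
    exact htwo _ (lt_sub_iff_add_lt'.2 hx)
  · rw [taylorExt, mul_div_cancel_right₀ _ hfac, Finset.sum_range_succ', add_sub_cancel_left]
    simp only [iteratedDerivWithin_zero, Nat.factorial_zero, Nat.cast_one, div_one, pow_zero,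
      mul_one]
    linarith
end

section
/- Let a₂ < a₁ ≤ b₁ < b₂ be real numbers. Let g : [a₂,a₁] → ℝ and h : [b₁,b₂] → ℝ be differentiable functions with g'(x) ≤ −2 for all x ∈ [a₂,a₁] and h'(y) ≤ −2 for all y ∈ [b₁,b₂]. Suppose g(a₁) < b₁, g(a₂) > b₂, h(b₁) > a₁, and h(b₂) < a₂. Then there exist a_* ∈ (a₂,a₁) and b_* ∈ (b₁,b₂) such that g(a_*) = b_* and h(b_*) = a_*. -/
open Set

/-- Two continuous functions on compact intervals, each overshooting the domain of the other
with reversed orientation, have a mutual fixed point in the interior. The proof applies the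
intermediate value theorem to `x ↦ h (max b₁ (min b₂ (g x))) - x`. -/
theorem exists_mutual_fixed_point_of_continuousOn {a₂ a₁ b₁ b₂ : ℝ} {g h : ℝ → ℝ}
    (ha : a₂ ≤ a₁) (hb : b₁ < b₂)
    (hg : ContinuousOn g (Icc a₂ a₁)) (hh : ContinuousOn h (Icc b₁ b₂))
    (hga1 : g a₁ < b₁) (hga2 : b₂ < g a₂) (hhb1 : a₁ < h b₁) (hhb2 : h b₂ < a₂) :
    ∃ x ∈ Ioo a₂ a₁, ∃ y ∈ Ioo b₁ b₂, g x = y ∧ h y = x := by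
  have hF : ContinuousOn (fun x => h (max b₁ (min b₂ (g x))) - x) (Icc a₂ a₁) := by
    refine (hh.comp (continuousOn_const.sup (continuousOn_const.inf hg)) ?_).sub continuousOn_id
    exact fun x _ => ⟨le_max_left _ _, max_le hb.le (min_le_left _ _)⟩
  have h0 : (0 : ℝ) ∈ Icc (h (max b₁ (min b₂ (g a₂))) - a₂) (h (max b₁ (min b₂ (g a₁))) - a₁) := by
    rw [min_eq_left hga2.le, max_eq_right hb.le, min_eq_right (hga1.trans hb).le,
      max_eq_left hga1.le]
    constructor <;> linarith
  obtain ⟨x, hx, hFx⟩ := intermediate_value_Icc ha hF h0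
  have hfix : h (max b₁ (min b₂ (g x))) = x := sub_eq_zero.mp hFx
  have hgx₁ : b₁ < g x := by
    by_contra! hle
    rw [min_eq_right (hle.trans hb.le), max_eq_left hle] at hfix
    linarith [hx.2]
  have hgx₂ : g x < b₂ := by
    by_contra! hle
    rw [min_eq_left hle, max_eq_right hb.le] at hfix
    linarith [hx.1]
  rw [min_eq_right hgx₂.le, max_eq_right hgx₁.le] at hfix
  have hx₂ : a₂ < x := hx.1.lt_of_ne (by rintro rfl; exact hga2.not_gt hgx₂)
  have hx₁ : x < a₁ := hx.2.lt_of_ne (by rintro rfl; exact hga1.not_gt hgx₁)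
  exact ⟨x, ⟨hx₂, hx₁⟩, g x, ⟨hgx₁, hgx₂⟩, rfl, hfix⟩

/-- **A mutual fixed point for two steep decreasing functions.** -/
theorem exists_mutual_fixed_point
    (a₂ a₁ b₁ b₂ : ℝ) (h21 : a₂ < a₁) (h1b : a₁ ≤ b₁) (hb12 : b₁ < b₂)
    (g h : ℝ → ℝ)
    (hgdiff : ∀ x ∈ Icc a₂ a₁, DifferentiableWithinAt ℝ g (Icc a₂ a₁) x)
    (hg' : ∀ x ∈ Icc a₂ a₁, derivWithin g (Icc a₂ a₁) x ≤ -2)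
    (hhdiff : ∀ y ∈ Icc b₁ b₂, DifferentiableWithinAt ℝ h (Icc b₁ b₂) y)
    (hh' : ∀ y ∈ Icc b₁ b₂, derivWithin h (Icc b₁ b₂) y ≤ -2)
    (hga1 : g a₁ < b₁) (hga2 : b₂ < g a₂) (hhb1 : a₁ < h b₁) (hhb2 : h b₂ < a₂) :
    ∃ ast ∈ Ioo a₂ a₁, ∃ bst ∈ Ioo b₁ b₂, g ast = bst ∧ h bst = ast := by
  have hgc : ContinuousOn g (Icc a₂ a₁) := fun x hx => (hgdiff x hx).continuousWithinAt
  have hhc : ContinuousOn h (Icc b₁ b₂) := fun y hy => (hhdiff y hy).continuousWithinAt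
  exact exists_mutual_fixed_point_of_continuousOn h21.le hb12 hgc hhc hga1 hga2 hhb1 hhb2
end

section
/- Let a₀ < a₁ < a < b < b₁ < b₀ be real numbers, θ > 1, r ∈ ℕ, and let F : [a₀,b₀] → [a₀,b₀] be an r-times continuously differentiable map with F({a₀,b₀}) ⊆ {a₀,b₀}, F([a₁,b₁]) ⊆ [a,b], and |F'(x)| > θ for all x ∈ [a₀,a₁) ∪ (b₁,b₀]. Set κ := min{θ/2, a−a₀, b₀−b}. Then for every r-times continuously differentiable function H : [a₀,b₀] → ℝ with H(a₀) = H(b₀) = 0 and ‖H‖_{C^r,[a₀,b₀]} < κ, the map F + H maps [a₀,b₀] into [a₀,b₀] and maps {a₀,b₀} into {a₀,b₀}. -/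
open Set

/-- The `C^r` norm of `g` on a set `S`: the sum over `0 ≤ i ≤ r` of the sup of
`|g⁽ⁱ⁾|` on `S`, derivatives taken within `S`. -/
noncomputable def crNormOn (r : ℕ) (S : Set ℝ) (g : ℝ → ℝ) : ℝ :=
  ∑ i ∈ Finset.range (r + 1), sSup ((fun x => |iteratedDerivWithin i g S x|) '' S)

/-- On a compact interval, every derivative of order at most `r` of a `C^r` function is bounded by
its `C^r` norm. -/
theorem abs_iteratedDerivWithin_le_crNormOn {r i : ℕ} {p q x : ℝ} {g : ℝ → ℝ} (hpq : p < q)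
    (hg : ContDiffOn ℝ r g (Icc p q)) (hi : i ≤ r) (hx : x ∈ Icc p q) :
    |iteratedDerivWithin i g (Icc p q) x| ≤ crNormOn r (Icc p q) g := by
  have hcont : ContinuousOn (iteratedDerivWithin i g (Icc p q)) (Icc p q) :=
    hg.continuousOn_iteratedDerivWithin (by exact_mod_cast hi) (uniqueDiffOn_Icc hpq)
  refine (le_csSup (isCompact_Icc.image_of_continuousOn hcont.abs).bddAbove
    (mem_image_of_mem _ hx)).trans ?_
  refine Finset.single_le_sum
    (f := fun i => sSup ((fun x => |iteratedDerivWithin i g (Icc p q) x|) '' Icc p q))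
    (fun j _ => Real.sSup_nonneg ?_) (Finset.mem_range.2 (Nat.lt_succ_of_le hi))
  rintro _ ⟨y, _, rfl⟩
  exact abs_nonneg _

/-- A continuous function on `[p, q]` takes values in `[c, d]` if it does so at the endpoints and
at all its interior critical points. -/
theorem mapsTo_Icc_of_critical_points {p q c d : ℝ} {g : ℝ → ℝ} (hpq : p ≤ q)
    (hg : ContinuousOn g (Icc p q)) (hp : g p ∈ Icc c d) (hq : g q ∈ Icc c d)
    (hcrit : ∀ x ∈ Ioo p q, deriv g x = 0 → g x ∈ Icc c d) :
    MapsTo g (Icc p q) (Icc c d) := by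
  have key : ∀ x ∈ Icc p q, IsExtrOn g (Icc p q) x → g x ∈ Icc c d := by
    intro x hx hext
    rcases hx.1.eq_or_lt with rfl | hpx
    · exact hp
    rcases hx.2.eq_or_lt with rfl | hxq
    · exact hq
    exact hcrit x ⟨hpx, hxq⟩ (hext.isLocalExtr (Icc_mem_nhds hpx hxq)).deriv_eq_zero
  obtain ⟨u, hu, humin⟩ := isCompact_Icc.exists_isMinOn (nonempty_Icc.2 hpq) hg
  obtain ⟨v, hv, hvmax⟩ := isCompact_Icc.exists_isMaxOn (nonempty_Icc.2 hpq) hg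
  intro x hx
  exact ⟨(key u hu humin.isExtr).1.trans (humin hx), (hvmax hx).trans (key v hv hvmax.isExtr).2⟩

/-- **Stability of the endpoint-preserving extension under small `C^r`
perturbations vanishing at the endpoints.** -/
theorem perturbation_remains_endpoint_preserving
    (a₀ a₁ a b b₁ b₀ θ : ℝ)
    (h01 : a₀ < a₁) (h1a : a₁ < a) (hab : a < b) (hb1 : b < b₁) (h10 : b₁ < b₀)
    (hθ : 1 < θ) (r : ℕ) (hr : 1 ≤ r)
    (F : ℝ → ℝ) (hF : ContDiffOn ℝ r F (Icc a₀ b₀))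
    (hFmaps : MapsTo F (Icc a₀ b₀) (Icc a₀ b₀))
    (hFa₀ : F a₀ ∈ ({a₀, b₀} : Set ℝ)) (hFb₀ : F b₀ ∈ ({a₀, b₀} : Set ℝ))
    (hFmid : MapsTo F (Icc a₁ b₁) (Icc a b))
    (hFexp : ∀ x ∈ Ico a₀ a₁ ∪ Ioc b₁ b₀, θ < |derivWithin F (Icc a₀ b₀) x|) :
    ∀ H : ℝ → ℝ, ContDiffOn ℝ r H (Icc a₀ b₀) → H a₀ = 0 → H b₀ = 0 →
      crNormOn r (Icc a₀ b₀) H < min (θ / 2) (min (a - a₀) (b₀ - b)) →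
      MapsTo (fun x => F x + H x) (Icc a₀ b₀) (Icc a₀ b₀) ∧
      F a₀ + H a₀ ∈ ({a₀, b₀} : Set ℝ) ∧ F b₀ + H b₀ ∈ ({a₀, b₀} : Set ℝ) := by
  intro H hH hHa₀ hHb₀ hnorm
  obtain ⟨hnθ, hn⟩ := lt_min_iff.1 hnorm
  obtain ⟨hna, hnb⟩ := lt_min_iff.1 hn
  have h00 : a₀ < b₀ := by linarith
  have hr' : (r : WithTop ℕ∞) ≠ 0 := by exact_mod_cast (Nat.one_le_iff_ne_zero.1 hr)
  have hGa₀ : F a₀ + H a₀ = F a₀ := by rw [hHa₀, add_zero]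
  have hGb₀ : F b₀ + H b₀ = F b₀ := by rw [hHb₀, add_zero]
  refine ⟨mapsTo_Icc_of_critical_points h00.le (hF.continuousOn.add hH.continuousOn) ?_ ?_ ?_,
    hGa₀.symm ▸ hFa₀, hGb₀.symm ▸ hFb₀⟩
  · simpa only [hGa₀] using hFmaps (left_mem_Icc.2 h00.le)
  · simpa only [hGb₀] using hFmaps (right_mem_Icc.2 h00.le)
  intro x hx hderiv
  have hx' := Ioo_subset_Icc_self hx
  by_cases hmid : x ∈ Icc a₁ b₁
  · have hFx := hFmid hmid
    have hHx := abs_iteratedDerivWithin_le_crNormOn h00 hH (Nat.zero_le r) hx'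
    rw [iteratedDerivWithin_zero] at hHx
    have := abs_le.1 hHx
    exact ⟨by linarith [hFx.1], by linarith [hFx.2]⟩
  · exfalso
    have hnhds : Icc a₀ b₀ ∈ nhds x := Icc_mem_nhds hx.1 hx.2
    have hFd : DifferentiableAt ℝ F x := (hF.differentiableOn hr' x hx').differentiableAt hnhds
    have hHd : DifferentiableAt ℝ H x := (hH.differentiableOn hr' x hx').differentiableAt hnhds
    have hexp : θ < |derivWithin F (Icc a₀ b₀) x| := by
      apply hFexp
      by_cases hxa : x < a₁
      · exact Or.inl ⟨hx'.1, hxa⟩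
      · exact Or.inr ⟨not_le.1 fun h => hmid ⟨not_lt.1 hxa, h⟩, hx'.2⟩
    have hHx := abs_iteratedDerivWithin_le_crNormOn h00 hH hr hx'
    rw [iteratedDerivWithin_one, derivWithin_of_mem_nhds hnhds] at hHx
    rw [derivWithin_of_mem_nhds hnhds] at hexp
    rw [deriv_fun_add hFd hHd] at hderiv
    rw [eq_neg_of_add_eq_zero_left hderiv, abs_neg] at hexp
    linarith
end

section
/- Let a₀ < a₁ < a < b < b₁ < b₀ be real numbers and σ > 1, and let G : [a₀,b₀] → [a₀,b₀] be a continuously differentiable map with G({a₀,b₀}) ⊆ {a₀,b₀}, G([a,b]) ⊆ [a,b], G([a₁,a] ∪ [b,b₁]) ⊆ [a,b], and |G'(x)| > σ for all x ∈ (a₀,a₁) ∪ (b₁,b₀). Then every G-invariant Borel probability measure on [a₀,b₀] is supported on [a,b] ∪ {a₀,b₀}. -/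
open MeasureTheory Set

/-- `μ` is a `G`-invariant Borel probability measure for the dynamical system
`G` restricted to `S` (the measure gives full mass to `S`). -/
def IsInvProbOn (G : ℝ → ℝ) (S : Set ℝ) (μ : Measure ℝ) : Prop :=
  IsProbabilityMeasure μ ∧ μ S = 1 ∧
    ∀ B : Set ℝ, MeasurableSet B → μ (G ⁻¹' B ∩ S) = μ B

/-- A function whose derivative exceeds `σ` in absolute value expands distances by `σ`. -/
lemma mul_sub_le_abs_sub_of_lt_abs_deriv {f : ℝ → ℝ} {p q σ : ℝ}
    (hf : ContinuousOn f (Icc p q)) (hd : DifferentiableOn ℝ f (Ioo p q))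
    (hexp : ∀ x ∈ Ioo p q, σ < |deriv f x|) {x y : ℝ} (hpx : p ≤ x) (hxy : x < y)
    (hyq : y ≤ q) : σ * (y - x) ≤ |f y - f x| := by
  obtain ⟨c, hc, hc'⟩ := exists_deriv_eq_slope f hxy (hf.mono (Icc_subset_Icc hpx hyq))
    (hd.mono (Ioo_subset_Ioo hpx hyq))
  have hc2 := hexp c ⟨hpx.trans_lt hc.1, hc.2.trans_le hyq⟩
  have hpos : 0 < y - x := sub_pos.2 hxy
  rw [hc', abs_div, abs_of_pos hpos, lt_div_iff₀ hpos] at hc2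
  exact hc2.le

/-- A continuous function with derivative bounded away from zero takes values between its
endpoint values. -/
lemma mem_uIcc_of_lt_abs_deriv {f : ℝ → ℝ} {p q σ : ℝ} (hσ : 0 < σ)
    (hf : ContinuousOn f (Icc p q)) (hd : DifferentiableOn ℝ f (Ioo p q))
    (hexp : ∀ x ∈ Ioo p q, σ < |deriv f x|) {x : ℝ} (hx : x ∈ Icc p q) :
    f x ∈ uIcc (f p) (f q) := by
  have key : ∀ u ∈ Icc p q, ∀ v ∈ Icc p q, u < v → f u ≠ f v := by
    intro u hu v hv huv h
    have := mul_sub_le_abs_sub_of_lt_abs_deriv hf hd hexp hu.1 huv hv.2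
    rw [h, sub_self, abs_zero] at this
    exact absurd (mul_pos hσ (sub_pos.2 huv)) this.not_gt
  have hinj : InjOn f (Icc p q) := by
    intro u hu v hv h
    rcases lt_trichotomy u v with h' | h' | h'
    · exact absurd h (key u hu v hv h')
    · exact h'
    · exact absurd h.symm (key v hv u hu h')
  have hpq : p ≤ q := hx.1.trans hx.2
  rcases hf.strictMonoOn_of_injOn_Icc' hpq hinj with hm | hm
  · exact mem_uIcc.2 (Or.inl ⟨hm.monotoneOn (left_mem_Icc.2 hpq) hx hx.1,
      hm.monotoneOn hx (right_mem_Icc.2 hpq) hx.2⟩)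
  · exact mem_uIcc.2 (Or.inr ⟨hm.antitoneOn hx (right_mem_Icc.2 hpq) hx.2,
      hm.antitoneOn (left_mem_Icc.2 hpq) hx hx.1⟩)

/-- If `G` maps every `V t` with `t > 0` into `V (σ * t)`, an invariant measure gives `V t` at
most the mass of `V (σ ^ n * t)`. -/
lemma IsInvProbOn.measure_le_iterate {G : ℝ → ℝ} {S : Set ℝ} {μ : Measure ℝ}
    (hμ : IsInvProbOn G S μ) {V : ℝ → Set ℝ} {σ : ℝ} (hσ : 0 < σ)
    (hVm : ∀ t, MeasurableSet (V t)) (hVS : ∀ t, 0 < t → V t ⊆ S)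
    (hGV : ∀ t, 0 < t → MapsTo G (V t) (V (σ * t))) {t : ℝ} (ht : 0 < t) (n : ℕ) :
    μ (V t) ≤ μ (V (σ ^ n * t)) := by
  induction n with
  | zero => simp
  | succ n ih =>
    have hpos : 0 < σ ^ n * t := by positivity
    calc μ (V t) ≤ μ (V (σ ^ n * t)) := ih
      _ ≤ μ (G ⁻¹' V (σ * (σ ^ n * t)) ∩ S) :=
        measure_mono fun x hx => ⟨hGV _ hpos hx, hVS _ hpos hx⟩
      _ = μ (V (σ ^ (n + 1) * t)) := by
        rw [hμ.2.2 _ (hVm _)]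
        congr 2
        ring

/-- **Localization of invariant measures.** For an endpoint-preserving
interval map that is uniformly expanding on the two outer gaps and maps the
collar `[a₁,a] ∪ [b,b₁]` into `[a,b]`, every invariant probability measure is
supported on `[a,b] ∪ {a₀,b₀}`. -/
theorem invariant_measure_supported_on_core
    (a₀ a₁ a b b₁ b₀ σ : ℝ)
    (h01 : a₀ < a₁) (h1a : a₁ < a) (hab : a < b) (hb1 : b < b₁) (h10 : b₁ < b₀)
    (hσ : 1 < σ)
    (G : ℝ → ℝ) (hG : ContDiffOn ℝ 1 G (Icc a₀ b₀))
    (hGmaps : MapsTo G (Icc a₀ b₀) (Icc a₀ b₀))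
    (hGa₀ : G a₀ ∈ ({a₀, b₀} : Set ℝ)) (hGb₀ : G b₀ ∈ ({a₀, b₀} : Set ℝ))
    (hGM : MapsTo G (Icc a b) (Icc a b))
    (hGcollar : MapsTo G (Icc a₁ a ∪ Icc b b₁) (Icc a b))
    (hGexp : ∀ x ∈ Ioo a₀ a₁ ∪ Ioo b₁ b₀, σ < |derivWithin G (Icc a₀ b₀) x|) :
    ∀ μ : Measure ℝ, IsInvProbOn G (Icc a₀ b₀) μ → μ (Icc a b ∪ {a₀, b₀}) = 1 := by
  intro μ hμ
  have hσ0 : 0 < σ := one_pos.trans hσ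
  have hderiv : ∀ x ∈ Ioo a₀ b₀, derivWithin G (Icc a₀ b₀) x = deriv G x := fun x hx =>
    derivWithin_of_mem_nhds (Icc_mem_nhds hx.1 hx.2)
  have hdiff : DifferentiableOn ℝ G (Ioo a₀ b₀) := fun x hx =>
    ((hG.differentiableOn one_ne_zero x (Ioo_subset_Icc_self hx)).differentiableAt
      (Icc_mem_nhds hx.1 hx.2)).differentiableWithinAt
  have hcL : ContinuousOn G (Icc a₀ a₁) :=
    hG.continuousOn.mono (Icc_subset_Icc le_rfl (by linarith))
  have hcR : ContinuousOn G (Icc b₁ b₀) :=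
    hG.continuousOn.mono (Icc_subset_Icc (by linarith) le_rfl)
  have hdL : DifferentiableOn ℝ G (Ioo a₀ a₁) :=
    hdiff.mono (Ioo_subset_Ioo le_rfl (by linarith))
  have hdR : DifferentiableOn ℝ G (Ioo b₁ b₀) :=
    hdiff.mono (Ioo_subset_Ioo (by linarith) le_rfl)
  have heL : ∀ x ∈ Ioo a₀ a₁, σ < |deriv G x| := fun x hx => by
    rw [← hderiv x ⟨hx.1, by linarith [hx.2]⟩]
    exact hGexp x (Or.inl hx)
  have heR : ∀ x ∈ Ioo b₁ b₀, σ < |deriv G x| := fun x hx => by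
    rw [← hderiv x ⟨by linarith [hx.1], hx.2⟩]
    exact hGexp x (Or.inr hx)
  have hGa₁ : G a₁ ∈ Icc a b := hGcollar (Or.inl ⟨le_rfl, h1a.le⟩)
  have hGb₁ : G b₁ ∈ Icc a b := hGcollar (Or.inr ⟨hb1.le, le_rfl⟩)
  have hGmid : MapsTo G (Icc a₁ b₁) (Icc a b) := by
    intro x hx
    rcases le_total x a with h | h
    · exact hGcollar (Or.inl ⟨hx.1, h⟩)
    · rcases le_total x b with h' | h'
      · exact hGM ⟨h, h'⟩
      · exact hGcollar (Or.inr ⟨h', hx.2⟩)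
  let V : ℝ → Set ℝ := fun t => Icc a₁ b₁ ∪ (Icc (a₀ + t) a₁ ∪ Icc b₁ (b₀ - t))
  have hVm : ∀ t, MeasurableSet (V t) := fun t =>
    measurableSet_Icc.union (measurableSet_Icc.union measurableSet_Icc)
  have hVS : ∀ t, 0 < t → V t ⊆ Icc a₀ b₀ := by
    rintro t ht x (hx | hx | hx) <;> constructor <;> linarith [hx.1, hx.2]
  -- a value between an endpoint and the core, at distance at least `t` from that endpoint
  have hVmem : ∀ {e c y t : ℝ}, e ∈ ({a₀, b₀} : Set ℝ) → c ∈ Icc a b → y ∈ uIcc e c →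
      t ≤ |y - e| → y ∈ V t := by
    intro e c y t he hc hy hty
    rcases he with rfl | rfl
    · rw [uIcc_of_le (by linarith [hc.1])] at hy
      rw [abs_of_nonneg (sub_nonneg.2 hy.1)] at hty
      rcases le_total y a₁ with h | h
      · exact Or.inr (Or.inl ⟨by linarith, h⟩)
      · exact Or.inl ⟨h, by linarith [hy.2, hc.2]⟩
    · rw [uIcc_of_ge (by linarith [hc.2])] at hy
      rw [abs_of_nonpos (sub_nonpos.2 hy.2)] at hty
      rcases le_total y b₁ with h | h
      · exact Or.inl ⟨by linarith [hy.1, hc.1], h⟩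
      · exact Or.inr (Or.inr ⟨h, by linarith⟩)
  have hGV : ∀ t, 0 < t → MapsTo G (V t) (V (σ * t)) := by
    rintro t ht x (hx | hx | hx)
    · have := hGmid hx
      exact Or.inl ⟨by linarith [this.1], by linarith [this.2]⟩
    · have hx0 : a₀ < x := by linarith [hx.1]
      refine hVmem hGa₀ hGa₁ (mem_uIcc_of_lt_abs_deriv hσ0 hcL hdL heL ⟨hx0.le, hx.2⟩) ?_
      refine le_trans ?_ (mul_sub_le_abs_sub_of_lt_abs_deriv hcL hdL heL le_rfl hx0 hx.2)
      exact mul_le_mul_of_nonneg_left (by linarith [hx.1]) hσ0.le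
    · have hx0 : x < b₀ := by linarith [hx.2]
      have hmem := mem_uIcc_of_lt_abs_deriv hσ0 hcR hdR heR ⟨hx.1, hx0.le⟩
      rw [uIcc_comm] at hmem
      refine hVmem hGb₀ hGb₁ hmem ?_
      rw [abs_sub_comm]
      refine le_trans ?_ (mul_sub_le_abs_sub_of_lt_abs_deriv hcR hdR heR hx.1 hx0 le_rfl)
      exact mul_le_mul_of_nonneg_left (by linarith [hx.2]) hσ0.le
  have hVle : ∀ t, 0 < t → μ (V t) ≤ μ (Icc a b) := by
    intro t ht
    obtain ⟨n, hn⟩ := pow_unbounded_of_one_lt ((b₀ - a₀) / t) hσ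
    rw [div_lt_iff₀ ht] at hn
    calc μ (V t) ≤ μ (V (σ ^ n * t)) := hμ.measure_le_iterate hσ0 hVm hVS hGV ht n
      _ ≤ μ (G ⁻¹' Icc a b ∩ Icc a₀ b₀) := by
        refine measure_mono ?_
        rintro x (hx | hx | hx)
        · exact ⟨hGmid hx, by linarith [hx.1], by linarith [hx.2]⟩
        · linarith [hx.1, hx.2]
        · linarith [hx.1, hx.2]
      _ = μ (Icc a b) := hμ.2.2 _ measurableSet_Icc
  have hprob : IsProbabilityMeasure μ := hμ.1
  have hnull : ∀ t, 0 < t → μ (V t \ Icc a b) = 0 := by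
    intro t ht
    have hsub : Icc a b ⊆ V t := (Icc_subset_Icc h1a.le hb1.le).trans subset_union_left
    rw [measure_sdiff hsub measurableSet_Icc.nullMeasurableSet (measure_ne_top μ _)]
    exact tsub_eq_zero_of_le (hVle t ht)
  have hU : μ (⋃ n : ℕ, V (1 / ((n : ℝ) + 1)) \ Icc a b) = 0 :=
    measure_iUnion_null fun n => hnull _ (by positivity)
  refine le_antisymm prob_le_one ?_
  calc (1 : ENNReal) = μ (Icc a₀ b₀) := hμ.2.1.symm
    _ ≤ μ ((Icc a b ∪ {a₀, b₀}) ∪ ⋃ n : ℕ, V (1 / ((n : ℝ) + 1)) \ Icc a b) := by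
      refine measure_mono fun x hx => ?_
      by_cases hxc : x ∈ Icc a b
      · exact Or.inl (Or.inl hxc)
      rcases hx.1.eq_or_lt with h | hax
      · exact Or.inl (Or.inr (Or.inl h.symm))
      rcases hx.2.eq_or_lt with h | hxb
      · exact Or.inl (Or.inr (Or.inr h))
      obtain ⟨n, hn⟩ := exists_nat_one_div_lt (lt_min (sub_pos.2 hax) (sub_pos.2 hxb))
      rw [lt_min_iff] at hn
      refine Or.inr (mem_iUnion.2 ⟨n, ?_, hxc⟩)
      rcases le_total x a₁ with h | h
      · exact Or.inr (Or.inl ⟨by linarith, h⟩)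
      rcases le_total x b₁ with h' | h'
      · exact Or.inl ⟨h, h'⟩
      · exact Or.inr (Or.inr ⟨h', by linarith⟩)
    _ ≤ μ (Icc a b ∪ {a₀, b₀}) + 0 := hU ▸ measure_union_le _ _
    _ = μ (Icc a b ∪ {a₀, b₀}) := add_zero _
end
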